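/- arXiv:0806.4820 — 2 statements merged into one kernel-verified Lean document; each statement's English description precedes it below -/
import Mathlib

section
/- Let (R, 𝔪) be a Noetherian local ring with dim R > 0 and R/𝔪 infinite, let I be a proper ideal of R, let M be a finitely generated R-module, and let d be a positive integer with dim_R M ≤ d. Then j_d(I, M) ≠ 0 if and only if ℓ(I, M) = d. -/
open Filter

noncomputable section

/-- The length of a module, as the height of `⊤` in the submodule lattice. -/
def mLength (R M : Type*) [CommRing R] [AddCommGroup M] [Module R M] : ℕ∞ :=
  Order.height (⊤ : Submodule R M)

/-- The Krull dimension of a module, via the annihilator. -/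
def mDim (R M : Type*) [CommRing R] [AddCommGroup M] [Module R M] : WithBot ℕ∞ :=
  ringKrullDim (R ⧸ Module.annihilator R M)

/-- `H⁰_I(N)`: elements killed by a power of `I` (0-th local cohomology). -/
def H0 {R : Type*} [CommRing R] (I : Ideal R) (N : Type*) [AddCommGroup N] [Module R N] :
    Submodule R N :=
  ⨆ n : ℕ, Submodule.torsionBySet R N ((I ^ n : Ideal R) : Set R)

/-- `IⁿM/I^{n+1}M`, as a submodule of `M/I^{n+1}M`. -/
def gradedPiece {R : Type*} [CommRing R] (I : Ideal R) {M : Type*} [AddCommGroup M]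
    [Module R M] (n : ℕ) : Submodule R (M ⧸ (I ^ (n + 1) • ⊤ : Submodule R M)) :=
  Submodule.map (I ^ (n + 1) • ⊤ : Submodule R M).mkQ (I ^ n • ⊤ : Submodule R M)

/-- The `j`-multiplicity `j_d(I, M)`, defined as
`lim_n (d−1)!/n^(d−1) · length_R (H⁰_𝔪(IⁿM/I^{n+1}M))`. -/
def jMult {R : Type*} [CommRing R] (𝔪 I : Ideal R) (M : Type*) [AddCommGroup M]
    [Module R M] (d : ℕ) : ℝ :=
  limUnder atTop fun n : ℕ =>
    ((d - 1).factorial : ℝ) / (n : ℝ) ^ (d - 1) *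
      ((mLength R (H0 𝔪 (gradedPiece I (M := M) n))).toNat : ℝ)

/-- `IⁿM/(𝔪IⁿM + I^{n+1}M)`, the `n`-th component of the special fiber module
`gr_I(M)/𝔪·gr_I(M)`.  -/
def fiberPiece {R : Type*} [CommRing R] (𝔪 I : Ideal R) {M : Type*} [AddCommGroup M]
    [Module R M] (n : ℕ) :
    Submodule R (M ⧸ (𝔪 • (I ^ n • ⊤) ⊔ I ^ (n + 1) • ⊤ : Submodule R M)) :=
  Submodule.map (𝔪 • (I ^ n • ⊤) ⊔ I ^ (n + 1) • ⊤ : Submodule R M).mkQ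
    (I ^ n • ⊤ : Submodule R M)

/-- The analytic spread `ℓ(I, M)`, i.e. the Krull dimension of
`gr_I(M)/𝔪·gr_I(M)` as a module over `gr_I(R)`: for a finitely generated graded module
over a standard graded algebra over an Artinian local ring this dimension equals the
(degree + 1) of the Hilbert polynomial `n ↦ length (IⁿM/(𝔪IⁿM + I^{n+1}M))`, which is the
least `δ` such that `length (IⁿM/(𝔪IⁿM + I^{n+1}M)) · (n+1) = O((n+1)^δ)`. -/
def analyticSpread {R : Type*} [CommRing R] (𝔪 I : Ideal R) (M : Type*) [AddCommGroup M]
    [Module R M] : ℕ :=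
  sInf {δ : ℕ | ∃ C : ℕ, ∀ n : ℕ,
    (mLength R (fiberPiece 𝔪 I (M := M) n)).toNat * (n + 1) ≤ C * (n + 1) ^ δ}

/-- The length of `(A + B) / A`. -/
def relLen {R M : Type*} [CommRing R] [AddCommGroup M] [Module R M] (A B : Submodule R M) : ℕ∞ :=
  Module.length R (B.map A.mkQ)

section RelLen

variable {R M P : Type*} [CommRing R] [AddCommGroup M] [Module R M] [AddCommGroup P] [Module R P]

lemma relLen_map (f : P →ₗ[R] M) (A : Submodule R M) (B : Submodule R P) :
    relLen A (B.map f) = relLen (A.comap f) B := by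
  have hinj : Function.Injective ((A.comap f).mapQ A f le_rfl) := by
    rw [← LinearMap.ker_eq_bot, Submodule.ker_mapQ]
    simp
  have h : (B.map f).map A.mkQ = (B.map (A.comap f).mkQ).map ((A.comap f).mapQ A f le_rfl) := by
    rw [← Submodule.map_comp, ← Submodule.map_comp, Submodule.mapQ_mkQ]
  unfold relLen
  rw [h]
  exact (Submodule.equivMapOfInjective _ hinj _).length_eq.symm

lemma relLen_congr_inf {A A' B : Submodule R M} (h : A ⊓ B = A' ⊓ B) :
    relLen A B = relLen A' B := by
  have key : ∀ A : Submodule R M, relLen A B = relLen (A.comap B.subtype) ⊤ := fun A => by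
    rw [← relLen_map, Submodule.map_subtype_top]
  have h' : A.comap B.subtype = A'.comap B.subtype := by
    refine Submodule.map_injective_of_injective B.injective_subtype ?_
    rw [Submodule.map_comap_subtype, Submodule.map_comap_subtype, inf_comm, h, inf_comm]
  rw [key, key, h']

lemma relLen_mono_right (A : Submodule R M) {B B' : Submodule R M} (h : B ≤ B') :
    relLen A B ≤ relLen A B' :=
  Module.length_le_of_injective (Submodule.inclusion (Submodule.map_mono h))
    (Submodule.inclusion_injective _)

lemma relLen_add {A B C : Submodule R M} (hAB : A ≤ B) (hBC : B ≤ C) :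
    relLen A C = relLen A B + relLen B C := by
  have hle : C.map A.mkQ ≤ (C.map B.mkQ).comap (Submodule.factor hAB) := by
    rw [← Submodule.map_le_iff_le_comap, ← Submodule.map_comp, Submodule.factor_comp_mk]
  refine Module.length_eq_add_of_exact (Submodule.inclusion (Submodule.map_mono hBC))
    ((Submodule.factor hAB).restrict hle) (Submodule.inclusion_injective _) ?_ ?_
  · rintro ⟨y, z, hz, rfl⟩
    exact ⟨⟨A.mkQ z, Submodule.mem_map_of_mem hz⟩, Subtype.ext rfl⟩
  · rintro ⟨y, z, hz, rfl⟩
    constructor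
    · intro h
      have h0 : B.mkQ z = 0 := congrArg Subtype.val h
      refine ⟨⟨A.mkQ z, Submodule.mem_map_of_mem ?_⟩, Subtype.ext rfl⟩
      simpa using h0
    · rintro ⟨⟨_, w, hw, rfl⟩, h⟩
      have h1 : A.mkQ w = A.mkQ z := congrArg Subtype.val h
      refine Subtype.ext ?_
      change Submodule.factor hAB (A.mkQ z) = 0
      rw [← h1]
      change B.mkQ w = 0
      simpa using hw

lemma relLen_self_sup (A B : Submodule R M) : relLen A (A ⊔ B) = relLen A B := by
  unfold relLen
  rw [Submodule.map_sup, Submodule.mkQ_map_self, bot_sup_eq]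

lemma relLen_anti_left {A A' : Submodule R M} (h : A ≤ A') (B : Submodule R M) :
    relLen A' B ≤ relLen A B := by
  have hle : B.map A.mkQ ≤ (B.map A'.mkQ).comap (Submodule.factor h) := by
    rw [← Submodule.map_le_iff_le_comap, ← Submodule.map_comp, Submodule.factor_comp_mk]
  refine Module.length_le_of_surjective ((Submodule.factor h).restrict hle) ?_
  rintro ⟨y, z, hz, rfl⟩
  exact ⟨⟨A.mkQ z, Submodule.mem_map_of_mem hz⟩, Subtype.ext rfl⟩

lemma relLen_eq_zero {A B : Submodule R M} : relLen A B = 0 ↔ B ≤ A := by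
  unfold relLen
  rw [Module.length_eq_zero_iff, Submodule.subsingleton_iff_eq_bot, ← le_bot_iff,
    Submodule.map_le_iff_le_comap]
  simp

lemma relLen_triangle (A B C : Submodule R M) : relLen A C ≤ relLen A B + relLen B C := by
  calc relLen A C ≤ relLen A (A ⊔ B ⊔ C) := relLen_mono_right _ le_sup_right
    _ = relLen A (A ⊔ B) + relLen (A ⊔ B) (A ⊔ B ⊔ C) := relLen_add le_sup_left le_sup_left
    _ = relLen A B + relLen (A ⊔ B) C := by rw [relLen_self_sup, relLen_self_sup]
    _ ≤ _ := by gcongr; exact relLen_anti_left le_sup_right _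

lemma relLen_sup_le (A B C : Submodule R M) : relLen A (B ⊔ C) ≤ relLen A B + relLen A C := by
  refine (relLen_triangle A (A ⊔ B) (B ⊔ C)).trans ?_
  rw [relLen_self_sup, ← relLen_self_sup _ (B ⊔ C)]
  have : A ⊔ B ⊔ (B ⊔ C) = (A ⊔ B) ⊔ C := by
    rw [← sup_assoc, sup_assoc A B B, sup_idem]
  rw [this, relLen_self_sup]
  gcongr
  exact relLen_anti_left le_sup_left _

lemma relLen_finset_sup_le {ι : Type*} (s : Finset ι) (A : Submodule R M)
    (B : ι → Submodule R M) : relLen A (⨆ i ∈ s, B i) ≤ ∑ i ∈ s, relLen A (B i) := by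
  classical
  induction s using Finset.induction_on with
  | empty => simp [relLen_eq_zero]
  | insert a s ha ih =>
    rw [Finset.iSup_insert, Finset.sum_insert ha]
    exact (relLen_sup_le _ _ _).trans (by gcongr)

end RelLen

lemma exists_pow_smul_eq_zero_of_associatedPrimes {A N : Type*} [CommRing A] [IsNoetherianRing A]
    [AddCommGroup N] [Module A N] {J : Ideal A} {y : A}
    (hy : ∀ P ∈ associatedPrimes A N, y ∈ P → J ≤ P) {z : N} (hz : y • z = 0) :
    ∃ k, ∀ a ∈ J ^ k, a • z = 0 := by
  let S := Submodule.span A {z}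
  have hyS : y ∈ Module.annihilator A S := by
    rw [Submodule.mem_annihilator_span_singleton]
    exact hz
  have hJ : J ≤ (Module.annihilator A S).radical := by
    rw [← Ideal.sInf_minimalPrimes]
    refine le_sInf fun P hP => ?_
    exact hy P (associatedPrimes.subset_of_injective S.injective_subtype
      (Module.associatedPrimes.minimalPrimes_annihilator_subset_associatedPrimes A S hP))
      (hP.1.2 hyS)
  obtain ⟨k, hk⟩ := Ideal.exists_pow_le_of_le_radical_of_fg hJ (IsNoetherian.noetherian J)
  refine ⟨k, fun a ha => ?_⟩
  have := hk ha
  rwa [Submodule.mem_annihilator_span_singleton] at this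

lemma IsLocalRing.exists_notMem_of_finite {R E : Type*} [CommRing R] [IsLocalRing R]
    [Infinite (IsLocalRing.ResidueField R)] [AddCommGroup E] [Module R E] [Module.Finite R E]
    {S : Set (Submodule R E)} (hS : S.Finite) (htop : ⊤ ∉ S) : ∃ x, ∀ V ∈ S, x ∉ V := by
  by_contra! h
  obtain ⟨V, hV, hfi⟩ := Submodule.exists_finiteIndex_of_cover (s := hS.toFinset) (p := id)
    (Set.eq_univ_of_forall fun x => by simpa using h x)
  have hV : V ≠ ⊤ := fun h => htop (h ▸ by simpa using hV)
  have : V.toAddSubgroup.FiniteIndex := hfi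
  have : Finite (E ⧸ V) := AddSubgroup.finite_quotient_of_finiteIndex (H := V.toAddSubgroup)
  have : Nontrivial (E ⧸ V) := Submodule.Quotient.nontrivial_iff.mpr hV
  let k := IsLocalRing.ResidueField R
  have hsurj := TensorProduct.mk_surjective R (E ⧸ V) k IsLocalRing.residue_surjective
  have : Finite (TensorProduct R k (E ⧸ V)) := Finite.of_surjective _ hsurj
  have : Nontrivial (TensorProduct R k (E ⧸ V)) := by
    rw [← not_subsingleton_iff_nontrivial, IsLocalRing.subsingleton_tensorProduct,
      not_subsingleton_iff_nontrivial]
    infer_instance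
  have : Infinite (TensorProduct R k (E ⧸ V)) := Module.Free.infinite k _
  exact not_finite (TensorProduct R k (E ⧸ V))

namespace Ideal.Filtration

variable {R M : Type*} [CommRing R] [AddCommGroup M] [Module R M] {I : Ideal R}

/-- The Rees algebra of `I`, as a commutative ring. -/
def ReesRing (I : Ideal R) : Type _ := reesAlgebra I

instance : CommRing (ReesRing I) := inferInstanceAs (CommRing (reesAlgebra I))

instance : Algebra R (ReesRing I) := inferInstanceAs (Algebra R (reesAlgebra I))

instance [IsNoetherianRing R] : IsNoetherianRing (ReesRing I) :=
  inferInstanceAs (IsNoetherianRing (reesAlgebra I))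

/-- The inclusion of the Rees algebra into the polynomial ring. -/
def ReesRing.toPolynomial (I : Ideal R) : ReesRing I →+* Polynomial R :=
  (reesAlgebra I).val.toRingHom

instance : Module (ReesRing I) (PolynomialModule R M) :=
  Module.compHom _ (ReesRing.toPolynomial I)

lemma ReesRing.smul_def (r : ReesRing I) (f : PolynomialModule R M) :
    r • f = ReesRing.toPolynomial I r • f := rfl

lemma ReesRing.toPolynomial_algebraMap (r : R) :
    ReesRing.toPolynomial I (algebraMap R (ReesRing I) r) = Polynomial.C r := rfl

/-- The Rees module of a filtration. -/
def reesModule (F : I.Filtration M) : Submodule (ReesRing I) (PolynomialModule R M) where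
  carrier := {f | ∀ i, f.coeff i ∈ F.N i}
  add_mem' hf hg i := add_mem (hf i) (hg i)
  zero_mem' _ := zero_mem _
  smul_mem' r _ hf := F.submodule.smul_mem r hf

lemma Stable.finite_reesModule [IsNoetherianRing R] [Module.Finite R M] {F : I.Filtration M}
    (hF : F.Stable) : Module.Finite (ReesRing I) F.reesModule := by
  rw [Module.Finite.iff_fg]
  obtain ⟨s, hs⟩ := (F.submodule_fg_iff_stable fun i => IsNoetherian.noetherian _).mpr hF
  refine ⟨s, le_antisymm (Submodule.span_le.mpr fun f hf => ?_) fun f hf => ?_⟩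
  · have : f ∈ F.submodule := hs ▸ Submodule.subset_span hf
    exact this
  · have hf' : f ∈ F.submodule := hf
    rw [← hs] at hf'
    induction hf' using Submodule.span_induction with
    | mem x h => exact Submodule.subset_span h
    | zero => exact zero_mem _
    | add x y hx hy h1 h2 =>
      refine add_mem (h1 ?_) (h2 ?_)
      · exact (hs ▸ hx : x ∈ F.submodule)
      · exact (hs ▸ hy : y ∈ F.submodule)
    | smul a x hx h =>
      exact Submodule.smul_mem _ (show ReesRing I from a) (h (hs ▸ hx : x ∈ F.submodule))

/-- The module `⨁ Fₙ / (Fₙ ∩ F'ₙ)` over the Rees algebra. -/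
abbrev ReesQuotient (F F' : I.Filtration M) : Type _ :=
  F.reesModule ⧸ F'.reesModule.submoduleOf F.reesModule

lemma finite_reesQuotient [IsNoetherianRing R] [Module.Finite R M] {F : I.Filtration M}
    (hF : F.Stable) (F' : I.Filtration M) : Module.Finite (ReesRing I) (F.ReesQuotient F') := by
  have := hF.finite_reesModule
  infer_instance

lemma single_mem_reesModule (F : I.Filtration M) {n : ℕ} {z : M} (hz : z ∈ F.N n) :
    PolynomialModule.single R n z ∈ F.reesModule := by
  intro i
  rw [PolynomialModule.coeff_single, Finsupp.single_apply]
  split_ifs with h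
  · exact h ▸ hz
  · exact zero_mem _

/-- The class of a homogeneous element. -/
def reesClass (F F' : I.Filtration M) (n : ℕ) (z : F.N n) : F.ReesQuotient F' :=
  Submodule.Quotient.mk ⟨PolynomialModule.single R n (z : M), F.single_mem_reesModule z.2⟩

lemma reesClass_eq_zero {F F' : I.Filtration M} {n : ℕ} {z : F.N n} :
    F.reesClass F' n z = 0 ↔ (z : M) ∈ F'.N n := by
  unfold reesClass
  rw [Submodule.Quotient.mk_eq_zero]
  change PolynomialModule.single R n (z : M) ∈ F'.reesModule ↔ _
  refine ⟨fun h => ?_, fun h => F'.single_mem_reesModule h⟩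
  simpa [PolynomialModule.coeff_single] using h n

/-- A homogeneous element of the Rees algebra. -/
def reesMonomial (I : Ideal R) (n : ℕ) (a : (I ^ n : Ideal R)) : ReesRing I :=
  ⟨Polynomial.monomial n (a : R), reesAlgebra.monomial_mem.mpr a.2⟩

lemma reesMonomial_smul_reesClass {F F' : I.Filtration M} {j n : ℕ} (a : (I ^ j : Ideal R))
    (z : F.N n) : reesMonomial I j a • F.reesClass F' n z =
      F.reesClass F' (j + n)
        ⟨(a : R) • (z : M), F.pow_smul_le j n (Submodule.smul_mem_smul a.2 z.2)⟩ := by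
  unfold reesClass
  rw [← Submodule.Quotient.mk_smul]
  congr 1
  exact Subtype.ext (PolynomialModule.monomial_smul_single j (a : R) n (z : M))

lemma reesMonomial_mem_pow {J : Ideal (ReesRing I)}
    (hJ : ∀ a : (I ^ 1 : Ideal R), reesMonomial I 1 a ∈ J) (k : ℕ) (a : (I ^ k : Ideal R)) :
    reesMonomial I k a ∈ J ^ k := by
  induction k with
  | zero => simp
  | succ k ih =>
    obtain ⟨a, ha⟩ := a
    have ha' := ha
    rw [pow_succ] at ha'
    have key : ∃ h : a ∈ I ^ (k + 1), reesMonomial I (k + 1) ⟨a, h⟩ ∈ J ^ (k + 1) := by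
      refine Submodule.mul_induction_on (C := fun a => ∃ h : a ∈ I ^ (k + 1),
        reesMonomial I (k + 1) ⟨a, h⟩ ∈ J ^ (k + 1)) ha' ?_ ?_
      · intro b hb c hc
        refine ⟨pow_succ I k ▸ Ideal.mul_mem_mul hb hc, ?_⟩
        have h1 := ih ⟨b, hb⟩
        have h2 := hJ ⟨c, by rwa [pow_one]⟩
        rw [pow_succ]
        convert Ideal.mul_mem_mul h1 h2 using 1
        refine Subtype.ext ?_
        change Polynomial.monomial (k + 1) (b * c) =
          Polynomial.monomial k b * Polynomial.monomial 1 c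
        rw [Polynomial.monomial_mul_monomial]
      · rintro b c ⟨hb, hb'⟩ ⟨hc, hc'⟩
        refine ⟨add_mem hb hc, ?_⟩
        convert add_mem hb' hc' using 1
        refine Subtype.ext ?_
        exact map_add (Polynomial.monomial (k + 1)) b c
    exact key.2

/-- The elements of `F` sent by `x` into the filtration `F'` shifted by one. -/
def colon (F F' : I.Filtration M) (x : R) : I.Filtration M where
  N n := F.N n ⊓ (F'.N (n + 1)).comap (LinearMap.lsmul R M x)
  mono n := inf_le_inf (F.mono n) (Submodule.comap_mono (F'.mono _))
  smul_le n := by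
    rw [Submodule.smul_le]
    rintro a ha z ⟨hz, hz'⟩
    refine ⟨F.smul_le n (Submodule.smul_mem_smul ha hz), ?_⟩
    have := F'.smul_le _ (Submodule.smul_mem_smul ha hz')
    change x • (a • z) ∈ F'.N (n + 1 + 1)
    rw [smul_comm]
    exact this

lemma exists_forall_smul_mem_imp [IsNoetherianRing R] [Module.Finite R M] {F F' : I.Filtration M}
    (hF : F.Stable) {x : R} (hx : x ∈ I ^ 1)
    (hP : ∀ P ∈ associatedPrimes (ReesRing I) (F.ReesQuotient F'),
      reesMonomial I 1 ⟨x, hx⟩ ∈ P → ∀ a, reesMonomial I 1 a ∈ P) :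
    ∃ n₀, ∀ n ≥ n₀, ∀ z ∈ F.N n, x • z ∈ F'.N (n + 1) → z ∈ F'.N n := by
  let J : Ideal (ReesRing I) := Ideal.span (Set.range (reesMonomial I 1))
  have hJ : ∀ a, reesMonomial I 1 a ∈ J := fun a => Ideal.subset_span ⟨a, rfl⟩
  have hK : (F.colon F' x).Stable := hF.of_le fun n => inf_le_left
  obtain ⟨n₁, hn₁⟩ := hK.exists_pow_smul_eq
  have hel : ∀ z ∈ (F.colon F' x).N n₁, ∃ k, ∀ a ∈ I ^ k, a • z ∈ F'.N (k + n₁) := by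
    rintro z ⟨hz, hz'⟩
    obtain ⟨k, hk⟩ := exists_pow_smul_eq_zero_of_associatedPrimes (J := J)
      (y := reesMonomial I 1 ⟨x, hx⟩) (N := F.ReesQuotient F')
      (fun P hPA hxP => Ideal.span_le.mpr (by rintro _ ⟨a, rfl⟩; exact hP P hPA hxP a))
      (z := F.reesClass F' n₁ ⟨z, hz⟩) (by
        rw [reesMonomial_smul_reesClass, reesClass_eq_zero]
        simpa [add_comm] using hz')
    refine ⟨k, fun a ha => ?_⟩
    have := hk _ (reesMonomial_mem_pow hJ k ⟨a, ha⟩)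
    rwa [reesMonomial_smul_reesClass, reesClass_eq_zero] at this
  have hunif : ∃ k, I ^ k • (F.colon F' x).N n₁ ≤ F'.N (k + n₁) := by
    obtain ⟨s, hs⟩ := IsNoetherian.noetherian ((F.colon F' x).N n₁)
    have hs' : ∀ z : s, ∃ k, ∀ a ∈ I ^ k, a • (z : M) ∈ F'.N (k + n₁) := fun z =>
      hel z (hs ▸ Submodule.subset_span z.2)
    choose k hk using hs'
    refine ⟨s.attach.sup k, ?_⟩
    rw [← hs, Submodule.smul_le]
    intro a ha z hz
    suffices (s : Set M) ⊆
        ((F'.N (s.attach.sup k + n₁)).comap (LinearMap.lsmul R M a) : Set M) from by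
      exact Submodule.span_le.mpr this hz
    intro w hw
    have hle : k ⟨w, hw⟩ ≤ s.attach.sup k := Finset.le_sup (Finset.mem_attach _ _)
    obtain ⟨t, ht⟩ := Nat.exists_eq_add_of_le hle
    rw [ht, add_comm, pow_add] at ha
    rw [ht, add_comm (k _) t, add_assoc]
    refine Submodule.mul_induction_on ha ?_ ?_
    · intro b hb c hc
      have := F'.pow_smul_le t _ (Submodule.smul_mem_smul hb (hk ⟨w, hw⟩ c hc))
      simpa [mul_smul] using this
    · intro b c hb hc
      change (b + c) • w ∈ F'.N (t + (k ⟨w, hw⟩ + n₁))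
      rw [add_smul]
      exact add_mem hb hc
  obtain ⟨k, hk⟩ := hunif
  refine ⟨n₁ + k, fun n hn z hz hxz => ?_⟩
  obtain ⟨i, rfl⟩ := Nat.exists_eq_add_of_le hn
  have hz' : z ∈ (F.colon F' x).N (n₁ + k + i) := ⟨hz, hxz⟩
  rw [add_assoc, hn₁, add_comm k i, pow_add, mul_smul] at hz'
  have := F'.pow_smul_le i _ (smul_mono_right _ hk hz')
  rwa [show n₁ + k + i = i + (k + n₁) by omega]

/-- A common superficial element for two filtrations. -/
lemma exists_superficial [IsNoetherianRing R] [IsLocalRing R]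
    [Infinite (IsLocalRing.ResidueField R)] [Module.Finite R M] {F : I.Filtration M}
    (hF : F.Stable) (F₁ F₂ : I.Filtration M) :
    ∃ x ∈ I, ∃ n₀, ∀ n ≥ n₀, ∀ z ∈ F.N n,
      (x • z ∈ F₁.N (n + 1) → z ∈ F₁.N n) ∧ (x • z ∈ F₂.N (n + 1) → z ∈ F₂.N n) := by
  have := finite_reesQuotient hF F₁
  have := finite_reesQuotient hF F₂
  let T : (I ^ 1 : Ideal R) →ₗ[R] ReesRing I :=
    { toFun := reesMonomial I 1
      map_add' := fun a b => Subtype.ext (map_add (Polynomial.monomial 1) (a : R) (b : R))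
      map_smul' := fun r a => Subtype.ext (map_smul (Polynomial.monomial 1) r (a : R)) }
  let V : Ideal (ReesRing I) → Submodule R (I ^ 1 : Ideal R) :=
    fun P => (P.restrictScalars R).comap T
  let A := associatedPrimes (ReesRing I) (F.ReesQuotient F₁) ∪
    associatedPrimes (ReesRing I) (F.ReesQuotient F₂)
  have hA : A.Finite := (associatedPrimes.finite _ _).union (associatedPrimes.finite _ _)
  obtain ⟨⟨x, hx⟩, hxV⟩ := IsLocalRing.exists_notMem_of_finite (S := (V '' A) \ {⊤})
    ((hA.image V).subset Set.sdiff_subset) (by simp)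
  have key : ∀ P ∈ A, reesMonomial I 1 ⟨x, hx⟩ ∈ P → ∀ a, reesMonomial I 1 a ∈ P := by
    intro P hP hxP a
    by_contra ha
    refine hxV (V P) ⟨⟨P, hP, rfl⟩, fun htop => ha ?_⟩ hxP
    have : a ∈ V P := htop ▸ Submodule.mem_top
    exact this
  obtain ⟨n₁, h₁⟩ := exists_forall_smul_mem_imp (F' := F₁) hF hx fun P hP => key P (Or.inl hP)
  obtain ⟨n₂, h₂⟩ := exists_forall_smul_mem_imp (F' := F₂) hF hx fun P hP => key P (Or.inr hP)
  exact ⟨x, by rwa [pow_one] at hx, max n₁ n₂, fun n hn z hz =>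
    ⟨h₁ n (le_of_max_le_left hn) z hz, h₂ n (le_of_max_le_right hn) z hz⟩⟩

end Ideal.Filtration

section

variable {R M P : Type*} [CommRing R] [AddCommGroup M] [Module R M] [AddCommGroup P] [Module R P]

lemma relLen_map_map_of_injective {f : P →ₗ[R] M} (hf : Function.Injective f)
    (A B : Submodule R P) : relLen (A.map f) (B.map f) = relLen A B := by
  rw [relLen_map, Submodule.comap_map_eq_of_injective hf]

lemma relLen_map_map (f : P →ₗ[R] M) (A B : Submodule R P) :
    relLen (A.map f) (B.map f) = relLen (A ⊔ LinearMap.ker f) B := by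
  rw [relLen_map, Submodule.comap_map_eq]

lemma relLen_eq_add_of_exact {f : M →ₗ[R] M} {q : M →ₗ[R] P}
    (hq : LinearMap.ker q = LinearMap.range f)
    {A B B' : Submodule R M} (hAB : A ≤ B) (hB : LinearMap.range f ⊓ B = B'.map f) :
    relLen A B = relLen (A.comap f) B' + relLen (A.map q) (B.map q) := by
  have hB' : B'.map f ≤ B := hB ▸ inf_le_right
  rw [relLen_add (le_sup_left : A ≤ A ⊔ B'.map f) (sup_le hAB hB'), relLen_self_sup, relLen_map,
    relLen_map_map, hq]
  congr 1
  refine relLen_congr_inf ?_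
  rw [inf_eq_left.mpr (sup_le hAB hB'), ← hB, sup_inf_assoc_of_le _ hAB]

/-- An element `x` of `I` that is regular on `M` and behaves like a regular form of degree one for
the `I`-adic filtrations of `M` and of `M` modulo `L`. -/
structure IsReducing (I : Ideal R) (L : Submodule R M) (x : R) : Prop where
  mem : x ∈ I
  regular : IsSMulRegular M x
  mem_of_smul_mem : ∀ (i : ℕ) (z : M), x • z ∈ (I ^ (i + 1) • ⊤ : Submodule R M) →
    z ∈ (I ^ i • ⊤ : Submodule R M)
  mem_of_smul_mem' : ∀ (i : ℕ), ∀ z ∈ (I ^ i • ⊤ : Submodule R M), x • z ∈ I ^ (i + 1) • L →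
    z ∈ I ^ i • L

lemma map_subtype_smul_top (N : Submodule R M) (J : Ideal R) :
    (J • ⊤ : Submodule R N).map N.subtype = J • N := by
  rw [Submodule.map_smul'', Submodule.map_subtype_top]

lemma map_subtype_smul_comap {N L : Submodule R M} (h : L ≤ N) (J : Ideal R) :
    (J • (L.comap N.subtype)).map N.subtype = J • L := by
  rw [Submodule.map_smul'', Submodule.map_comap_subtype, inf_eq_right.mpr h]

lemma exists_isReducing [IsNoetherianRing R] [IsLocalRing R]
    [Infinite (IsLocalRing.ResidueField R)] [Module.Finite R M] {I : Ideal R}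
    (hI : I ≠ ⊤) (L : Submodule R M) :
    ∃ n₀ x, IsReducing I ((I ^ n₀ • L).comap (I ^ n₀ • ⊤ : Submodule R M).subtype) x := by
  let F₂ : I.Filtration M :=
    { N := fun n => I ^ (n + 1) • ⊤
      mono := fun n => (I.stableFiltration ⊤).mono (n + 1)
      smul_le := fun n => (I.stableFiltration ⊤).smul_le (n + 1) }
  obtain ⟨x, hx, n₀, h⟩ := Ideal.Filtration.exists_superficial
    (I.stableFiltration_stable (⊤ : Submodule R M)) (I.stableFiltration L) F₂
  have anti : ∀ {a b : ℕ}, a ≤ b → (I ^ b • ⊤ : Submodule R M) ≤ I ^ a • ⊤ := fun hab =>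
    Submodule.smul_mono_left (Ideal.pow_le_pow_right hab)
  have h1 : ∀ n ≥ n₀, ∀ z ∈ (I ^ n • ⊤ : Submodule R M), x • z ∈ I ^ (n + 1) • L →
    z ∈ I ^ n • L := fun n hn z hz => (h n hn z hz).1
  have h2 : ∀ n ≥ n₀, ∀ z ∈ (I ^ n • ⊤ : Submodule R M),
    x • z ∈ (I ^ (n + 2) • ⊤ : Submodule R M) → z ∈ (I ^ (n + 1) • ⊤ : Submodule R M) :=
    fun n hn z hz => (h n hn z hz).2
  have h3 : ∀ (i : ℕ), ∀ z ∈ (I ^ n₀ • ⊤ : Submodule R M),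
      x • z ∈ (I ^ (i + 1 + n₀) • ⊤ : Submodule R M) → z ∈ (I ^ (i + n₀) • ⊤ : Submodule R M) := by
    intro i z hz
    induction i with
    | zero => intro _; simpa using hz
    | succ i ih =>
      intro hxz
      have := h2 (i + n₀) (by omega) z (ih (anti (by omega) hxz))
        (by rwa [show i + n₀ + 2 = i + 1 + 1 + n₀ by omega])
      rwa [show i + 1 + n₀ = i + n₀ + 1 by omega]
  have hpow : ∀ (i : ℕ) (N : Submodule R M), I ^ i • I ^ n₀ • N = I ^ (i + n₀) • N := fun i N => by
    rw [pow_add, mul_smul]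
  have hmem : ∀ {N : Submodule R M} (A : Submodule R N) (z : N),
      z ∈ A ↔ (z : M) ∈ A.map N.subtype := fun A z => by simp
  have hLM : I ^ n₀ • L ≤ (I ^ n₀ • ⊤ : Submodule R M) := smul_mono_right _ le_top
  refine ⟨n₀, x, hx, ?_, ?_, ?_⟩
  · rw [isSMulRegular_iff_right_eq_zero_of_smul]
    rintro ⟨z, hz⟩ hxz
    have hxz : x • z = 0 := congrArg Subtype.val hxz
    refine Subtype.ext ?_
    have : z ∈ (⨅ i : ℕ, I ^ i • ⊤ : Submodule R M) := by
      rw [Submodule.mem_iInf]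
      exact fun i => anti (Nat.le_add_right i n₀) (h3 i z hz (hxz ▸ zero_mem _))
    rwa [Ideal.iInf_pow_smul_eq_bot_of_isLocalRing I hI, Submodule.mem_bot] at this
  · intro i z hz
    rw [hmem, map_subtype_smul_top, hpow] at hz ⊢
    exact h3 i z z.2 hz
  · intro i z hz hxz
    rw [hmem, map_subtype_smul_top, hpow] at hz
    rw [hmem, map_subtype_smul_comap hLM, hpow] at hxz ⊢
    exact h1 (i + n₀) (by omega) z hz (by rwa [show i + n₀ + 1 = i + 1 + n₀ by omega])

open Pointwise in
lemma ker_mkQ_smul_top (x : R) :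
    LinearMap.ker (x • (⊤ : Submodule R M)).mkQ = LinearMap.range (LinearMap.lsmul R M x) := by
  rw [Submodule.ker_mkQ]
  ext z
  simp [Submodule.mem_smul_pointwise_iff_exists]

namespace IsReducing

variable {I : Ideal R} {L : Submodule R M} {x : R}

lemma range_inf (h : IsReducing I L x) (i : ℕ) :
    LinearMap.range (LinearMap.lsmul R M x) ⊓ (I ^ (i + 1) • ⊤ : Submodule R M) =
      (I ^ i • ⊤ : Submodule R M).map (LinearMap.lsmul R M x) := by
  apply le_antisymm
  · rintro _ ⟨⟨z, rfl⟩, hz⟩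
    exact ⟨z, h.mem_of_smul_mem i z hz, rfl⟩
  · rintro _ ⟨z, hz, rfl⟩
    refine ⟨⟨z, rfl⟩, ?_⟩
    rw [pow_succ', mul_smul]
    exact Submodule.smul_mem_smul h.mem hz

lemma supportDim_add_one [IsLocalRing R] [IsNoetherianRing R] [Module.Finite R M]
    (h : IsReducing I L x) (hI : I ≠ ⊤) :
    Module.supportDim R (QuotSMulTop x M) + 1 = Module.supportDim R M :=
  Module.supportDim_quotSMulTop_succ_eq_supportDim h.regular
    (IsLocalRing.le_maximalIdeal hI h.mem)

end IsReducing

end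

section

variable {R : Type*} {M : Type*} [CommRing R] [AddCommGroup M] [Module R M]

lemma relLen_top (A : Submodule R M) : relLen A ⊤ = Module.length R (M ⧸ A) := by
  unfold relLen
  rw [Submodule.map_top, Submodule.range_mkQ, Module.length_top]

lemma relLen_span_singleton_le_one {𝔪 : Ideal R} [𝔪.IsMaximal] {A : Submodule R M} {z : M}
    (h : ∀ a ∈ 𝔪, a • z ∈ A) : relLen A (R ∙ z) ≤ 1 := by
  rw [← LinearMap.range_toSpanSingleton, ← Submodule.map_top, relLen_map]
  have : IsSimpleModule R (R ⧸ 𝔪) := isSimpleModule_iff_isCoatom.mpr (Ideal.IsMaximal.out)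
  refine (relLen_anti_left (A := 𝔪) h _).trans ?_
  rw [relLen_top, Module.length_eq_one]

lemma relLen_smul_sup_ne_top {𝔪 : Ideal R} [𝔪.IsMaximal] {N : Submodule R M} (hN : N.FG)
    (Z : Submodule R M) : relLen (𝔪 • N ⊔ Z) N ≠ ⊤ := by
  obtain ⟨s, hs⟩ := hN
  have h : N ≤ ⨆ z ∈ s, R ∙ z := by
    rw [← hs, Submodule.span_le]
    exact fun z hz => Submodule.mem_iSup_of_mem z
      (Submodule.mem_iSup_of_mem hz (Submodule.mem_span_singleton_self z))
  have h2 := (relLen_mono_right (𝔪 • N ⊔ Z) h).trans (relLen_finset_sup_le s _ _)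
  refine ne_top_of_le_ne_top ?_ (h2.trans (Finset.sum_le_sum (g := fun _ => (1 : ℕ∞)) fun z hz =>
    relLen_span_singleton_le_one (𝔪 := 𝔪) fun a ha => ?_))
  · simp
  · exact Submodule.mem_sup_left
      (Submodule.smul_mem_smul ha (hs ▸ Submodule.subset_span hz))

lemma span_smul_le_iSup (s : Finset R) (N : Submodule R M) :
    Ideal.span (s : Set R) • N ≤ ⨆ a ∈ s, N.map (LinearMap.lsmul R M a) := by
  rw [Submodule.smul_le]
  intro r hr z hz
  induction hr using Submodule.span_induction with
  | mem a ha =>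
    exact Submodule.mem_iSup_of_mem a (Submodule.mem_iSup_of_mem ha ⟨z, hz, rfl⟩)
  | zero => rw [zero_smul]; exact zero_mem _
  | add a b _ _ h1 h2 => rw [add_smul]; exact add_mem h1 h2
  | smul a b _ h => rw [smul_assoc]; exact Submodule.smul_mem _ _ h

lemma exists_relLen_pow_smul_sup_le [IsNoetherianRing R] (𝔪 : Ideal R) (j : ℕ) :
    ∃ C : ℕ, ∀ N Z : Submodule R M,
      relLen (𝔪 ^ j • N ⊔ Z) N ≤ C * relLen (𝔪 • N ⊔ Z) N := by
  induction j with
  | zero =>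
    refine ⟨0, fun N Z => ?_⟩
    rw [relLen_eq_zero.mpr]
    · simp
    · simp
  | succ j ih =>
    obtain ⟨C, hC⟩ := ih
    obtain ⟨s, hs⟩ := IsNoetherian.noetherian (𝔪 ^ j)
    refine ⟨s.card + C, fun N Z => ?_⟩
    have h1 : relLen (𝔪 ^ (j + 1) • N ⊔ Z) (𝔪 ^ j • N ⊔ Z) ≤
        s.card * relLen (𝔪 • N ⊔ Z) N := by
      refine (relLen_sup_le _ _ _).trans ?_
      rw [relLen_eq_zero.mpr (le_sup_right : Z ≤ _), add_zero]
      have h2 : 𝔪 ^ j • N ≤ ⨆ a ∈ s, N.map (LinearMap.lsmul R M a) := by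
        conv_lhs => rw [← hs]
        exact span_smul_le_iSup s N
      refine (relLen_mono_right _ h2).trans ((relLen_finset_sup_le _ _ _).trans ?_)
      refine (Finset.sum_le_sum (g := fun _ => relLen (𝔪 • N ⊔ Z) N) fun a ha => ?_).trans ?_
      · rw [relLen_map]
        refine relLen_anti_left (sup_le ?_ ?_) _
        · rw [← Submodule.map_le_iff_le_comap, Submodule.map_smul'']
          refine le_sup_of_le_left ?_
          rw [pow_succ', mul_smul]
          refine smul_mono_right _ ?_
          rintro _ ⟨z, hz, rfl⟩
          exact Submodule.smul_mem_smul (hs ▸ Submodule.subset_span ha) hz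
        · intro z hz
          exact Submodule.mem_sup_right (Submodule.smul_mem _ _ hz)
      · rw [Finset.sum_const, nsmul_eq_mul]
    calc relLen (𝔪 ^ (j + 1) • N ⊔ Z) N
        ≤ relLen (𝔪 ^ (j + 1) • N ⊔ Z) (𝔪 ^ j • N ⊔ Z) + relLen (𝔪 ^ j • N ⊔ Z) N :=
          relLen_triangle _ _ _
      _ ≤ s.card * relLen (𝔪 • N ⊔ Z) N + C * relLen (𝔪 • N ⊔ Z) N := add_le_add h1 (hC _ _)
      _ = _ := by push_cast; rw [add_mul]

lemma relLen_pow_smul_sup_ne_top [IsNoetherianRing R] {𝔪 : Ideal R} [𝔪.IsMaximal]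
    {N : Submodule R M} (hN : N.FG) (Z : Submodule R M) (j : ℕ) :
    relLen (𝔪 ^ j • N ⊔ Z) N ≠ ⊤ := by
  obtain ⟨C, hC⟩ := exists_relLen_pow_smul_sup_le (M := M) 𝔪 j
  exact ne_top_of_le_ne_top
    (WithTop.mul_ne_top (ENat.natCast_ne_top C) (relLen_smul_sup_ne_top hN Z)) (hC N Z)

end

section

open Module

lemma WithBot.lt_of_add_one_lt_add_one {a : WithBot ℕ∞} {e : ℕ} (h : a + 1 < (e + 1 : ℕ)) :
    a < e := by
  induction a with
  | bot => exact WithBot.bot_lt_coe _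
  | coe a =>
    have h' : a + 1 < ((e + 1 : ℕ) : ℕ∞) := by exact_mod_cast h
    have : a < (e : ℕ∞) := by
      push_cast at h'
      exact lt_of_add_lt_add_right h'
    exact_mod_cast this

lemma WithBot.eq_bot_of_lt_zero {a : WithBot ℕ∞} (h : a < (0 : ℕ)) : a = ⊥ := by
  induction a with
  | bot => rfl
  | coe a =>
    have h' : a < ((0 : ℕ) : ℕ∞) := by exact_mod_cast h
    simp at h'

lemma Nat.multichoose_le_pow (e j : ℕ) : Nat.multichoose (e + 1) j ≤ (j + 1) ^ e := by
  induction e generalizing j with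
  | zero => simp [Nat.multichoose_one]
  | succ e ih =>
    induction j with
    | zero => simp
    | succ j ihj =>
      rw [Nat.multichoose_succ_succ]
      calc _ ≤ (j + 1 + 1) ^ e + (j + 1) ^ (e + 1) := add_le_add (ih _) ihj
        _ ≤ (j + 1 + 1) ^ e + (j + 1) * (j + 1 + 1) ^ e := by
          rw [pow_succ', Nat.add_le_add_iff_left]
          gcongr
          omega
        _ = _ := by ring

lemma Nat.multichoose_succ_mono (e : ℕ) : Monotone (Nat.multichoose (e + 1)) :=
  monotone_nat_of_le_succ fun j => by
    rw [Nat.multichoose_succ_succ]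
    exact Nat.le_add_left _ _

lemma Nat.one_le_multichoose_succ (e j : ℕ) : 1 ≤ Nat.multichoose (e + 1) j := by
  simpa using Nat.multichoose_succ_mono e (Nat.zero_le j)

section

variable {R : Type*} [CommRing R]

open IsLocalRing Pointwise

lemma map_mkQ_smul_top_top {M : Type*} [AddCommGroup M] [Module R M] (N : Submodule R M)
    (J : Ideal R) : (J • ⊤ : Submodule R M).map N.mkQ = J • ⊤ := by
  rw [Submodule.map_smul'', Submodule.map_top, Submodule.range_mkQ]

variable [IsNoetherianRing R] [IsLocalRing R]

lemma relLen_pow_smul_top_ne_top {M : Type*} [AddCommGroup M] [Module R M] [Module.Finite R M]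
    (j : ℕ) : relLen (maximalIdeal R ^ j • ⊤ : Submodule R M) ⊤ ≠ ⊤ := by
  have := relLen_pow_smul_sup_ne_top (𝔪 := maximalIdeal R) (Module.Finite.fg_top (R := R) (M := M))
    ⊥ j
  rwa [sup_bot_eq] at this

variable [Infinite (IsLocalRing.ResidueField R)]

/-- An upper bound for the Hilbert–Samuel function. -/
theorem exists_relLen_pow_smul_top_le (e : ℕ) : ∀ (M : Type*) [AddCommGroup M] [Module R M]
    [Module.Finite R M], supportDim R M < e → ∃ C : ℕ, ∀ j,
      relLen (maximalIdeal R ^ j • ⊤ : Submodule R M) ⊤ ≤ (C * Nat.multichoose e j : ℕ) := by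
  induction e with
  | zero =>
    intro M _ _ _ h
    refine ⟨0, fun j => ?_⟩
    have := (supportDim_eq_bot_iff_subsingleton _ _).mp (WithBot.eq_bot_of_lt_zero h)
    rw [relLen_eq_zero.mpr (le_of_eq (Subsingleton.elim _ _))]
    exact zero_le
  | succ e ih =>
    intro M _ _ _ h
    obtain ⟨n₀, x, hx⟩ := exists_isReducing (IsLocalRing.maximalIdeal.isMaximal R).ne_top
      (⊤ : Submodule R M)
    set N := (maximalIdeal R ^ n₀ • ⊤ : Submodule R M) with hN
    have hdim := hx.supportDim_add_one (IsLocalRing.maximalIdeal.isMaximal R).ne_top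
    have hle : supportDim R N ≤ supportDim R M :=
      supportDim_le_of_injective N.subtype N.injective_subtype
    obtain ⟨C, hC⟩ := ih (QuotSMulTop x N)
      (WithBot.lt_of_add_one_lt_add_one ((hdim.trans_le hle).trans_lt h))
    have hrec : ∀ j, relLen (maximalIdeal R ^ j • ⊤ : Submodule R N) ⊤ ≤
        (C * Nat.multichoose (e + 1) j : ℕ) := by
      intro j
      induction j with
      | zero => rw [relLen_eq_zero.mpr (by simp)]; exact zero_le
      | succ j ihj =>
        rw [relLen_eq_add_of_exact (ker_mkQ_smul_top x) (B' := ⊤) le_top (by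
          rw [inf_top_eq, Submodule.map_top]), map_mkQ_smul_top_top, Submodule.map_top,
          Submodule.range_mkQ]
        refine (add_le_add ((relLen_anti_left ?_ _).trans ihj) (hC (j + 1))).trans ?_
        · rw [← Submodule.map_le_iff_le_comap, ← hx.range_inf]
          exact inf_le_right
        · rw [Nat.multichoose_succ_succ]
          norm_cast
          rw [mul_add, add_comm]
    obtain ⟨c₀, hc₀⟩ := ENat.ne_top_iff_exists.mp
      (relLen_pow_smul_top_ne_top (R := R) (M := M) n₀)
    refine ⟨c₀ + C, fun j => ?_⟩
    calc relLen (maximalIdeal R ^ j • ⊤ : Submodule R M) ⊤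
        ≤ relLen (maximalIdeal R ^ j • N) ⊤ :=
          relLen_anti_left (smul_mono_right _ le_top) _
      _ ≤ relLen (maximalIdeal R ^ j • N) N + relLen N ⊤ := relLen_triangle _ _ _
      _ ≤ (C * Nat.multichoose (e + 1) j : ℕ) + c₀ := by
          refine add_le_add ?_ hc₀.ge
          refine le_trans (le_of_eq ?_) (hrec j)
          rw [← relLen_map_map_of_injective N.injective_subtype, map_subtype_smul_top,
            Submodule.map_subtype_top]
      _ ≤ _ := by
          norm_cast
          have := Nat.one_le_multichoose_succ e j
          nlinarith

end

end

section

open Module IsLocalRing Pointwise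

section
variable {R : Type*} [CommRing R]

lemma IsReducing.map_lsmul_le {M : Type*} [AddCommGroup M] [Module R M] {I : Ideal R}
    {L : Submodule R M} {x : R} (h : IsReducing I L x) (n : ℕ) :
    (I ^ n • ⊤ : Submodule R M).map (LinearMap.lsmul R M x) ≤ I ^ (n + 1) • ⊤ :=
  (h.range_inf n).symm.trans_le inf_le_right

variable [IsNoetherianRing R] [IsLocalRing R] [Infinite (ResidueField R)]

/-- An upper bound for the lengths of the graded pieces of `gr_I(M)/𝔪ʲ gr_I(M)`. -/
theorem exists_relLen_fiber_le {I : Ideal R} (hI : I ≠ ⊤) (e : ℕ) : ∀ (M : Type*)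
    [AddCommGroup M] [Module R M] [Module.Finite R M], supportDim R M < (e + 1 : ℕ) →
    ∃ n₀ C : ℕ, ∀ n ≥ n₀, ∀ j, relLen
      (maximalIdeal R ^ j • (I ^ n • ⊤) ⊔ I ^ (n + 1) • ⊤ : Submodule R M) (I ^ n • ⊤) ≤
        (C * Nat.multichoose e (n + j) : ℕ) := by
  induction e with
  | zero =>
    intro M _ _ _ h
    obtain ⟨n₀, x, hx⟩ := exists_isReducing hI (⊤ : Submodule R M)
    have hdim := hx.supportDim_add_one hI
    have hle := supportDim_le_of_injective (R := R) _
      (I ^ n₀ • ⊤ : Submodule R M).injective_subtype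
    have hbot := WithBot.eq_bot_of_lt_zero
      (WithBot.lt_of_add_one_lt_add_one ((hdim.trans_le hle).trans_lt h))
    rw [hbot, WithBot.bot_add] at hdim
    have := (supportDim_eq_bot_iff_subsingleton _ _).mp hdim.symm
    have h0 : (I ^ n₀ • ⊤ : Submodule R M) = ⊥ := Submodule.subsingleton_iff_eq_bot.mp this
    refine ⟨n₀, 0, fun n hn j => ?_⟩
    have : (I ^ n • ⊤ : Submodule R M) = ⊥ :=
      le_bot_iff.mp (h0 ▸ Submodule.smul_mono_left (Ideal.pow_le_pow_right hn))
    rw [this, relLen_eq_zero.mpr bot_le]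
    exact zero_le
  | succ e ih =>
    intro M _ _ _ h
    obtain ⟨n₀, x, hx⟩ := exists_isReducing hI (⊤ : Submodule R M)
    set N := (I ^ n₀ • ⊤ : Submodule R M) with hN
    have hdim := hx.supportDim_add_one hI
    have hle : supportDim R N ≤ supportDim R M :=
      supportDim_le_of_injective N.subtype N.injective_subtype
    obtain ⟨n₁, C, hC⟩ := ih (QuotSMulTop x N)
      (WithBot.lt_of_add_one_lt_add_one ((hdim.trans_le hle).trans_lt h))
    let N' : Submodule R N := I ^ n₁ • ⊤
    have hreg : IsSMulRegular N' x := hx.regular.submodule N' x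
    have hdim' := supportDim_quotSMulTop_succ_eq_supportDim (R := R) (M := N') hreg
      (le_maximalIdeal hI hx.mem)
    have hle' : supportDim R N' ≤ supportDim R N :=
      supportDim_le_of_injective N'.subtype N'.injective_subtype
    obtain ⟨C', hC'⟩ := exists_relLen_pow_smul_top_le (e + 1) (QuotSMulTop x N')
      (WithBot.lt_of_add_one_lt_add_one ((hdim'.trans_le (hle'.trans hle)).trans_lt h))
    have hstart : ∀ j, relLen
        (maximalIdeal R ^ j • (I ^ n₁ • ⊤) ⊔ I ^ (n₁ + 1) • ⊤ : Submodule R N) (I ^ n₁ • ⊤) ≤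
          (C' * Nat.multichoose (e + 1) j : ℕ) := by
      intro j
      refine le_trans ?_ (hC' j)
      rw [← map_mkQ_smul_top_top (M := N') (x • (⊤ : Submodule R N')),
        ← Submodule.range_mkQ (x • (⊤ : Submodule R N')), ← Submodule.map_top,
        relLen_map_map, ker_mkQ_smul_top, ← relLen_map_map_of_injective N'.injective_subtype,
        Submodule.map_subtype_top, Submodule.map_sup, map_subtype_smul_top]
      refine relLen_anti_left (sup_le_sup_left ?_ _) _
      rintro _ ⟨_, ⟨z, rfl⟩, rfl⟩
      exact hx.map_lsmul_le n₁ ⟨z, z.2, rfl⟩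
    have hrec : ∀ n ≥ n₁, ∀ j, relLen
        (maximalIdeal R ^ j • (I ^ n • ⊤) ⊔ I ^ (n + 1) • ⊤ : Submodule R N) (I ^ n • ⊤) ≤
          ((C + C') * Nat.multichoose (e + 1) (n + j) : ℕ) := by
      intro n hn j
      induction n, hn using Nat.le_induction with
      | base =>
        refine (hstart j).trans ?_
        have := Nat.multichoose_succ_mono e (Nat.le_add_left j n₁)
        norm_cast
        gcongr
        omega
      | succ n hn ihn =>
        rw [relLen_eq_add_of_exact (ker_mkQ_smul_top x) (B' := I ^ n • ⊤)
          (sup_le Submodule.smul_le_right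
            (Submodule.smul_mono_left (Ideal.pow_le_pow_right (Nat.le_succ _))))
          (hx.range_inf n), Submodule.map_sup, Submodule.map_smul'' (maximalIdeal R ^ j),
          map_mkQ_smul_top_top, map_mkQ_smul_top_top]
        refine (add_le_add ((relLen_anti_left ?_ _).trans ihn)
          (hC (n + 1) (by omega) j)).trans ?_
        · rw [← Submodule.map_le_iff_le_comap, Submodule.map_sup, Submodule.map_smul'']
          exact sup_le_sup (smul_mono_right _ (hx.map_lsmul_le n)) (hx.map_lsmul_le (n + 1))
        · rw [add_right_comm n 1 j, Nat.multichoose_succ_succ]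
          norm_cast
          nlinarith [Nat.zero_le (C' * Nat.multichoose e (n + j + 1))]
    refine ⟨n₁ + n₀, C + C', fun n hn j => ?_⟩
    obtain ⟨i, rfl⟩ := Nat.exists_eq_add_of_le hn
    have hpow : ∀ a, I ^ a • I ^ n₀ • (⊤ : Submodule R M) = I ^ (a + n₀) • ⊤ := fun a => by
      rw [pow_add, mul_smul]
    have hi := hrec (n₁ + i) (by omega) j
    rw [← relLen_map_map_of_injective N.injective_subtype, Submodule.map_sup,
      Submodule.map_smul'' (maximalIdeal R ^ j), map_subtype_smul_top, map_subtype_smul_top, hN,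
      hpow, hpow,
      show n₁ + i + n₀ = n₁ + n₀ + i by omega, show n₁ + i + 1 + n₀ = n₁ + n₀ + i + 1 by omega]
      at hi
    refine hi.trans ?_
    have := Nat.multichoose_succ_mono e (show n₁ + i + j ≤ n₁ + n₀ + i + j by omega)
    norm_cast
    gcongr

end

end

section

open Module IsLocalRing Pointwise

/-- `h` is finite and given by a polynomial for large arguments. -/
def EventuallyPolynomial (h : ℕ → ℕ∞) : Prop :=
  ∃ p : Polynomial ℚ, ∃ n₀, ∀ n ≥ n₀, ∃ a : ℕ, h n = a ∧ (a : ℚ) = p.eval (n : ℚ)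

lemma Polynomial.exists_antidifference (p : Polynomial ℚ) :
    ∃ q : Polynomial ℚ, ∀ t, q.eval (1 + t) = q.eval t + p.eval t := by
  induction p using Polynomial.induction_on' with
  | add p₁ p₂ h₁ h₂ =>
    obtain ⟨q₁, h₁⟩ := h₁
    obtain ⟨q₂, h₂⟩ := h₂
    refine ⟨q₁ + q₂, fun t => ?_⟩
    simp only [Polynomial.eval_add, h₁, h₂]
    ring
  | monomial n c =>
    refine ⟨Polynomial.C (c / (n + 1)) * Polynomial.bernoulli (n + 1), fun t => ?_⟩
    have : (n : ℚ) + 1 ≠ 0 := by positivity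
    simp only [Polynomial.eval_mul, Polynomial.eval_C, Polynomial.bernoulli_eval_one_add,
      Polynomial.eval_monomial]
    push_cast
    field_simp

lemma EventuallyPolynomial.of_shift {h : ℕ → ℕ∞} {k : ℕ}
    (hh : EventuallyPolynomial fun n => h (n + k)) : EventuallyPolynomial h := by
  obtain ⟨p, n₀, hp⟩ := hh
  refine ⟨p.comp (Polynomial.X - Polynomial.C (k : ℚ)), n₀ + k, fun n hn => ?_⟩
  obtain ⟨i, rfl⟩ := Nat.exists_eq_add_of_le' (le_of_add_le_right hn)
  obtain ⟨a, ha, ha'⟩ := hp i (by omega)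
  exact ⟨a, ha, by simp [ha']⟩

lemma EventuallyPolynomial.of_add {h g : ℕ → ℕ∞} (hh : ∀ n, h n ≠ ⊤)
    (hg : EventuallyPolynomial g) (hrec : ∀ n, h (n + 1) = h n + g (n + 1)) :
    EventuallyPolynomial h := by
  obtain ⟨p, n₀, hp⟩ := hg
  obtain ⟨q, hq⟩ := (p.comp (1 + Polynomial.X)).exists_antidifference
  choose a ha using fun n => ENat.ne_top_iff_exists.mp (hh n)
  refine ⟨q + Polynomial.C ((a n₀ : ℚ) - q.eval (n₀ : ℚ)), n₀, fun n hn => ⟨a n, (ha n).symm, ?_⟩⟩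
  induction n, hn using Nat.le_induction with
  | base => simp
  | succ n hn ih =>
    obtain ⟨b, hb, hb'⟩ := hp (n + 1) (by omega)
    have h1 := hrec n
    rw [hb, ← ha, ← ha] at h1
    have h2 : a (n + 1) = a n + b := by exact_mod_cast h1
    have h3 := hq n
    simp only [Polynomial.eval_add, Polynomial.eval_C, Polynomial.eval_comp, Polynomial.eval_one,
      Polynomial.eval_X] at ih h3 ⊢
    push_cast [h2] at hb' ⊢
    rw [add_comm (n : ℚ) 1] at hb' ⊢
    rw [ih, hb', h3]
    ring

section
variable {R : Type*} [CommRing R] [IsNoetherianRing R] [IsLocalRing R]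

lemma relLen_pow_smul_ne_top {M : Type*} [AddCommGroup M] [Module R M] [Module.Finite R M]
    (I : Ideal R) {L : Submodule R M} {k : ℕ} (hk : maximalIdeal R ^ k • ⊤ ≤ L) (n : ℕ) :
    relLen (I ^ n • L) (I ^ n • ⊤) ≠ ⊤ := by
  refine ne_top_of_le_ne_top (relLen_pow_smul_sup_ne_top (𝔪 := maximalIdeal R)
    (IsNoetherian.noetherian (I ^ n • ⊤ : Submodule R M)) ⊥ k) (relLen_anti_left ?_ _)
  rw [sup_bot_eq, smul_comm]
  exact smul_mono_right _ hk

variable [Infinite (ResidueField R)]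

/-- The length of `IⁿM / IⁿL` is eventually polynomial in `n`. -/
theorem eventuallyPolynomial_relLen {I : Ideal R} (hI : I ≠ ⊤) (k e : ℕ) : ∀ (M : Type*)
    [AddCommGroup M] [Module R M] [Module.Finite R M], supportDim R M < e →
    ∀ L : Submodule R M, maximalIdeal R ^ k • ⊤ ≤ L →
      EventuallyPolynomial fun n => relLen (I ^ n • L) (I ^ n • ⊤) := by
  induction e with
  | zero =>
    intro M _ _ _ h L hL
    have := (supportDim_eq_bot_iff_subsingleton _ _).mp (WithBot.eq_bot_of_lt_zero h)
    refine ⟨0, 0, fun n _ => ⟨0, ?_, by simp⟩⟩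
    exact relLen_eq_zero.mpr (le_of_eq (Subsingleton.elim _ _))
  | succ e ih =>
    intro M _ _ _ h L hL
    obtain ⟨n₀, x, hx⟩ := exists_isReducing hI L
    set N := (I ^ n₀ • ⊤ : Submodule R M) with hN
    set L₁ := (I ^ n₀ • L).comap N.subtype with hL₁
    have hLN : I ^ n₀ • L ≤ N := smul_mono_right _ le_top
    have hkL₁ : maximalIdeal R ^ k • ⊤ ≤ L₁ := by
      rw [hL₁, ← Submodule.map_le_iff_le_comap, map_subtype_smul_top, hN, smul_comm]
      exact smul_mono_right _ hL
    have hdim := hx.supportDim_add_one hI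
    have hle : supportDim R N ≤ supportDim R M :=
      supportDim_le_of_injective N.subtype N.injective_subtype
    have hQ := ih (QuotSMulTop x N)
      (WithBot.lt_of_add_one_lt_add_one ((hdim.trans_le hle).trans_lt h))
      (L₁.map (x • (⊤ : Submodule R N)).mkQ) (by
        rw [← map_mkQ_smul_top_top]
        exact Submodule.map_mono hkL₁)
    have hN' : EventuallyPolynomial fun n => relLen (I ^ n • L₁) (I ^ n • ⊤) := by
      refine EventuallyPolynomial.of_add (relLen_pow_smul_ne_top I hkL₁) hQ fun n => ?_
      rw [relLen_eq_add_of_exact (ker_mkQ_smul_top x) (smul_mono_right _ le_top)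
        (hx.range_inf n), map_mkQ_smul_top_top, Submodule.map_smul'']
      congr 1
      refine relLen_congr_inf (le_antisymm ?_ (inf_le_inf_right _ ?_))
      · exact fun z hz => ⟨hx.mem_of_smul_mem' n z hz.2 hz.1, hz.2⟩
      · intro z hz
        change x • z ∈ I ^ (n + 1) • L₁
        rw [pow_succ', mul_smul]
        exact Submodule.smul_mem_smul hx.mem hz
    refine EventuallyPolynomial.of_shift (k := n₀) ?_
    convert hN' using 2 with n
    rw [← relLen_map_map_of_injective N.injective_subtype, map_subtype_smul_top,
      map_subtype_smul_comap hLN, hN, pow_add, mul_smul, mul_smul]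

end

end

section

section
variable {R M : Type*} [CommRing R] [AddCommGroup M] [Module R M]

lemma Submodule.FG.exists_pow_smul_le {N : Submodule R M} (hN : N.FG) {A : Submodule R M}
    {J : Ideal R} (h : ∀ z ∈ N, ∃ k, ∀ a ∈ J ^ k, a • z ∈ A) : ∃ k, J ^ k • N ≤ A := by
  obtain ⟨s, hs⟩ := hN
  have hs' : ∀ z : s, ∃ k, ∀ a ∈ J ^ k, a • (z : M) ∈ A := fun z =>
    h z (hs ▸ Submodule.subset_span z.2)
  choose k hk using hs'
  refine ⟨s.attach.sup k, ?_⟩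
  rw [← hs, Submodule.smul_le]
  intro a ha z hz
  have : (s : Set M) ⊆ (A.comap (LinearMap.lsmul R M a) : Set M) := fun w hw =>
    hk ⟨w, hw⟩ a (Ideal.pow_le_pow_right (Finset.le_sup (Finset.mem_attach _ ⟨w, hw⟩)) ha)
  exact Submodule.span_le.mpr this hz

/-- The elements of `B` sent into `A` by a power of `J`. -/
def Submodule.saturationIn (J : Ideal R) (A B : Submodule R M) : Submodule R M where
  carrier := {z | z ∈ B ∧ ∃ k, ∀ a ∈ J ^ k, a • z ∈ A}
  zero_mem' := ⟨zero_mem _, 0, fun a _ => by rw [smul_zero]; exact zero_mem _⟩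
  add_mem' := by
    rintro z w ⟨hz, k, hk⟩ ⟨hw, l, hl⟩
    refine ⟨add_mem hz hw, max k l, fun a ha => ?_⟩
    rw [smul_add]
    exact add_mem (hk a (Ideal.pow_le_pow_right (le_max_left _ _) ha))
      (hl a (Ideal.pow_le_pow_right (le_max_right _ _) ha))
  smul_mem' := by
    rintro r z ⟨hz, k, hk⟩
    refine ⟨Submodule.smul_mem _ _ hz, k, fun a ha => ?_⟩
    rw [smul_comm]
    exact Submodule.smul_mem _ _ (hk a ha)

lemma Submodule.le_saturationIn {J : Ideal R} {A B : Submodule R M} (h : A ≤ B) :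
    A ≤ saturationIn J A B := fun _ hz => ⟨h hz, 0, fun _ _ => Submodule.smul_mem _ _ hz⟩

lemma exists_pow_smul_inf_torsion_eq_bot [IsNoetherianRing R] [Module.Finite R M] (J : Ideal R) :
    ∃ s, ∀ z ∈ (J ^ s • ⊤ : Submodule R M), (∃ k, ∀ a ∈ J ^ k, a • z = 0) → z = 0 := by
  let T := Submodule.saturationIn J (⊥ : Submodule R M) ⊤
  obtain ⟨k, hk⟩ := (IsNoetherian.noetherian T).exists_pow_smul_le (A := ⊥) (J := J)
    fun z hz => hz.2
  obtain ⟨c, hc⟩ := J.exists_pow_inf_eq_pow_smul T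
  refine ⟨c + k, fun z hz hzT => ?_⟩
  have hz' : z ∈ J ^ (c + k) • ⊤ ⊓ T := ⟨hz, trivial, by simpa using hzT⟩
  rw [hc _ (by omega), Nat.add_sub_cancel_left] at hz'
  have hle : J ^ k • (J ^ c • ⊤ ⊓ T) ≤ J ^ k • T := smul_mono_right _ inf_le_right
  exact (Submodule.mem_bot R).mp (hk (hle hz'))

lemma exists_mem_pow_smul_sub_torsion [IsNoetherianRing R] [Module.Finite R M] (J : Ideal R)
    {y : R} (hy : ∀ P ∈ associatedPrimes R M, y ∈ P → J ≤ P) :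
    ∃ c, ∀ j ≥ c, ∀ z : M, y • z ∈ (J ^ j • ⊤ : Submodule R M) →
      ∃ w ∈ (J ^ (j - c) • ⊤ : Submodule R M), ∃ k, ∀ a ∈ J ^ k, a • (z - w) = 0 := by
  obtain ⟨c, hc⟩ := J.exists_pow_inf_eq_pow_smul (LinearMap.range (LinearMap.lsmul R M y))
  refine ⟨c, fun j hj z hz => ?_⟩
  have h1 : y • z ∈ J ^ j • ⊤ ⊓ LinearMap.range (LinearMap.lsmul R M y) := ⟨hz, z, rfl⟩
  rw [hc j hj] at h1
  have h2 : y • z ∈ J ^ (j - c) • LinearMap.range (LinearMap.lsmul R M y) :=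
    Submodule.smul_mono le_rfl inf_le_right h1
  rw [← Submodule.map_top, ← Submodule.map_smul''] at h2
  obtain ⟨w, hw, hwz⟩ := h2
  refine ⟨w, hw, exists_pow_smul_eq_zero_of_associatedPrimes hy ?_⟩
  have : y • w = y • z := hwz
  rw [smul_sub, this, sub_self]

/-- The shifted `I`-adic filtration `n ↦ Iⁿ⁺¹M`. -/
def Ideal.succFiltration (I : Ideal R) (M : Type*) [AddCommGroup M] [Module R M] :
    I.Filtration M where
  N n := I ^ (n + 1) • ⊤
  mono n := (I.stableFiltration ⊤).mono (n + 1)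
  smul_le n := (I.stableFiltration ⊤).smul_le (n + 1)

lemma Ideal.pow_succ_smul_top_le (I : Ideal R) (n : ℕ) :
    (I ^ (n + 1) • ⊤ : Submodule R M) ≤ I ^ n • ⊤ :=
  (I.stableFiltration ⊤).mono n

/-- The filtration `n ↦ {z ∈ IⁿM | 𝔪ᵏz ⊆ Iⁿ⁺¹M for some k}`. -/
def Ideal.saturatedFiltration (𝔪 I : Ideal R) (M : Type*) [AddCommGroup M] [Module R M] :
    I.Filtration M where
  N n := Submodule.saturationIn 𝔪 (I ^ (n + 1) • ⊤) (I ^ n • ⊤)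
  mono n := by
    rintro z ⟨hz, -⟩
    exact Submodule.le_saturationIn (I.pow_succ_smul_top_le n) hz
  smul_le n := by
    rw [Submodule.smul_le]
    rintro a ha z ⟨hz, k, hk⟩
    refine ⟨(I.stableFiltration ⊤).smul_le n (Submodule.smul_mem_smul ha hz), k, fun b hb => ?_⟩
    rw [smul_comm]
    exact (I.stableFiltration ⊤).smul_le (n + 1) (Submodule.smul_mem_smul ha (hk b hb))

lemma Ideal.pow_succ_smul_top_le_saturatedFiltration (𝔪 I : Ideal R) (n : ℕ) :
    (I ^ (n + 1) • ⊤ : Submodule R M) ≤ (Ideal.saturatedFiltration 𝔪 I M).N n :=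
  Submodule.le_saturationIn (I.pow_succ_smul_top_le n)

lemma Ideal.saturatedFiltration_le (𝔪 I : Ideal R) (n : ℕ) :
    (Ideal.saturatedFiltration 𝔪 I M).N n ≤ I ^ n • ⊤ := fun _ hz => hz.1

lemma Ideal.saturatedFiltration_stable [IsNoetherianRing R] [Module.Finite R M] (𝔪 I : Ideal R) :
    (Ideal.saturatedFiltration 𝔪 I M).Stable :=
  (I.stableFiltration_stable ⊤).of_le (Ideal.saturatedFiltration_le 𝔪 I)

open IsLocalRing in
/-- The length of `H⁰_𝔪(IⁿM / Iⁿ⁺¹M)` is eventually polynomial in `n`. -/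
theorem eventuallyPolynomial_relLen_saturated [IsNoetherianRing R] [IsLocalRing R]
    [Infinite (ResidueField R)] [Module.Finite R M] {I : Ideal R} (hI : I ≠ ⊤) {e : ℕ}
    (he : Module.supportDim R M < e) :
    EventuallyPolynomial fun n => relLen (I ^ (n + 1) • ⊤ : Submodule R M)
      ((Ideal.saturatedFiltration (maximalIdeal R) I M).N n) := by
  obtain ⟨n₀, hn₀⟩ := (Ideal.saturatedFiltration_stable (M := M)
    (maximalIdeal R) I).exists_pow_smul_eq
  set N := (Ideal.saturatedFiltration (maximalIdeal R) I M).N n₀ with hN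
  obtain ⟨k, hk⟩ := (IsNoetherian.noetherian N).exists_pow_smul_le
    (A := I ^ (n₀ + 1) • ⊤) (J := maximalIdeal R) fun z hz => hz.2
  have hle := Ideal.pow_succ_smul_top_le_saturatedFiltration (M := M) (maximalIdeal R) I n₀
  refine EventuallyPolynomial.of_shift (k := n₀) ?_
  convert eventuallyPolynomial_relLen hI k e N
    ((Module.supportDim_le_of_injective N.subtype N.injective_subtype).trans_lt he)
    ((I ^ (n₀ + 1) • ⊤ : Submodule R M).comap N.subtype) ?_ using 2 with n
  · rw [← relLen_map_map_of_injective N.injective_subtype, map_subtype_smul_top,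
      map_subtype_smul_comap hle, add_comm n, hn₀, ← mul_smul, ← pow_add,
      show n + (n₀ + 1) = n₀ + n + 1 by omega]
  · rw [← Submodule.map_le_iff_le_comap, map_subtype_smul_top]
    exact hk

end

end

namespace Ideal.Filtration

variable {R M : Type*} [CommRing R] [AddCommGroup M] [Module R M] {I : Ideal R}
  {F F' : I.Filtration M}

lemma ReesRing.algebraMap_smul (r : R) (f : PolynomialModule R M) :
    algebraMap R (ReesRing I) r • f = r • f := by
  rw [ReesRing.smul_def, ReesRing.toPolynomial_algebraMap]
  exact _root_.algebraMap_smul (R := R) (Polynomial R) r f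

lemma reesClass_add {n : ℕ} (z w : F.N n) :
    F.reesClass F' n (z + w) = F.reesClass F' n z + F.reesClass F' n w := by
  unfold reesClass
  rw [← Submodule.Quotient.mk_add]
  congr 1
  exact Subtype.ext (map_add (PolynomialModule.lsingle R n) (z : M) w)

lemma algebraMap_smul_reesClass {n : ℕ} (r : R) (z : F.N n) :
    algebraMap R (ReesRing I) r • F.reesClass F' n z = F.reesClass F' n (r • z) := by
  unfold reesClass
  rw [← Submodule.Quotient.mk_smul]
  congr 1
  refine Subtype.ext ?_
  change algebraMap R (ReesRing I) r • PolynomialModule.single R n (z : M) = _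
  rw [ReesRing.algebraMap_smul]
  exact (map_smul (PolynomialModule.lsingle R n) r (z : M)).symm

lemma reesClass_mem_map_smul_top {𝔞 : Ideal R} {n : ℕ} {z : F.N n} (hz : (z : M) ∈ 𝔞 • F.N n) :
    F.reesClass F' n z ∈ (𝔞.map (algebraMap R (ReesRing I)) • ⊤ :
      Submodule (ReesRing I) (F.ReesQuotient F')) := by
  obtain ⟨z, hzF⟩ := z
  change z ∈ _ at hz
  have key : ∃ h : z ∈ F.N n, F.reesClass F' n ⟨z, h⟩ ∈
      (𝔞.map (algebraMap R (ReesRing I)) • ⊤ :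
        Submodule (ReesRing I) (F.ReesQuotient F')) := by
    refine Submodule.smul_induction_on (p := fun z => ∃ h : z ∈ F.N n, F.reesClass F' n ⟨z, h⟩ ∈
      (𝔞.map (algebraMap R (ReesRing I)) • ⊤ :
        Submodule (ReesRing I) (F.ReesQuotient F'))) hz ?_ ?_
    · intro r hr w hw
      refine ⟨Submodule.smul_mem _ _ hw, ?_⟩
      have := algebraMap_smul_reesClass (F' := F') r ⟨w, hw⟩
      change F.reesClass F' n (r • ⟨w, hw⟩) ∈ _
      rw [← this]
      exact Submodule.smul_mem_smul (Ideal.mem_map_of_mem _ hr) trivial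
    · rintro a b ⟨h1, h1'⟩ ⟨h2, h2'⟩
      refine ⟨add_mem h1 h2, ?_⟩
      change F.reesClass F' n (⟨a, h1⟩ + ⟨b, h2⟩) ∈ _
      rw [reesClass_add]
      exact add_mem h1' h2'
  exact key.2

lemma coeff_mem_smul {𝔞 : Ideal R} {r : ReesRing I}
    (hr : r ∈ 𝔞.map (algebraMap R (ReesRing I))) {f : PolynomialModule R M}
    (hf : f ∈ F.reesModule) (n : ℕ) : (r • f).coeff n ∈ 𝔞 • F.N n := by
  induction hr using Submodule.span_induction generalizing f with
  | mem r hr =>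
    obtain ⟨a, ha, rfl⟩ := hr
    rw [ReesRing.algebraMap_smul]
    exact Submodule.smul_mem_smul ha (hf n)
  | zero => rw [zero_smul]; exact zero_mem _
  | add r s _ _ h1 h2 =>
    rw [add_smul]
    exact add_mem (h1 hf) (h2 hf)
  | smul s r _ h =>
    rw [smul_eq_mul, mul_comm, mul_smul]
    exact h (Submodule.smul_mem _ _ hf)

lemma exists_of_mem_map_smul_top {𝔞 : Ideal R} {w : F.ReesQuotient F'}
    (hw : w ∈ (𝔞.map (algebraMap R (ReesRing I)) • ⊤ :
      Submodule (ReesRing I) (F.ReesQuotient F'))) :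
    ∃ f : F.reesModule, Submodule.Quotient.mk f = w ∧
      ∀ n, (f : PolynomialModule R M).coeff n ∈ 𝔞 • F.N n := by
  refine Submodule.smul_induction_on hw ?_ ?_
  · intro r hr w _
    obtain ⟨f, rfl⟩ := Submodule.Quotient.mk_surjective _ w
    exact ⟨r • f, rfl, coeff_mem_smul hr f.2⟩
  · rintro _ _ ⟨f, rfl, hf⟩ ⟨g, rfl, hg⟩
    exact ⟨f + g, rfl, fun n => add_mem (hf n) (hg n)⟩

lemma smul_sub_mem_of_algebraMap_smul_eq_zero {n : ℕ} {z : F.N n} {f : F.reesModule} {a : R}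
    (h : algebraMap R (ReesRing I) a •
      (F.reesClass F' n z - Submodule.Quotient.mk f : F.ReesQuotient F') = 0) :
    a • ((z : M) - (f : PolynomialModule R M).coeff n) ∈ F'.N n := by
  unfold reesClass at h
  rw [← Submodule.Quotient.mk_sub, ← Submodule.Quotient.mk_smul,
    Submodule.Quotient.mk_eq_zero] at h
  have h' : algebraMap R (ReesRing I) a • (PolynomialModule.single R n (z : M) - f) ∈
    F'.reesModule := h
  rw [ReesRing.algebraMap_smul] at h'
  have h2 := h' n
  have h3 : (a • (PolynomialModule.single R n (z : M) - f)).coeff n =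
      a • ((PolynomialModule.single R n (z : M)).coeff n -
        (f : PolynomialModule R M).coeff n) := rfl
  rw [h3, PolynomialModule.coeff_single, Finsupp.single_eq_same] at h2
  exact h2

end Ideal.Filtration

namespace Ideal.Filtration

section
variable {R M : Type*} [CommRing R] [AddCommGroup M] [Module R M] [IsNoetherianRing R]
  [Module.Finite R M]

lemma exists_saturatedFiltration_inf_le (𝔪 I : Ideal R) :
    ∃ s, ∀ n, (𝔪 ^ s • (I ^ n • ⊤) ⊔ I ^ (n + 1) • ⊤ : Submodule R M) ⊓
      (saturatedFiltration 𝔪 I M).N n ≤ I ^ (n + 1) • ⊤ := by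
  let F := I.stableFiltration (⊤ : Submodule R M)
  have := finite_reesQuotient (I.stableFiltration_stable (⊤ : Submodule R M))
    (I.succFiltration M)
  obtain ⟨s, hs⟩ := exists_pow_smul_inf_torsion_eq_bot
    (M := F.ReesQuotient (I.succFiltration M)) (𝔪.map (algebraMap R (ReesRing I)))
  refine ⟨s, fun n => ?_⟩
  rw [sup_comm, sup_inf_assoc_of_le _ (pow_succ_smul_top_le_saturatedFiltration 𝔪 I n)]
  refine sup_le le_rfl ?_
  rintro z ⟨hz, hzn, k, hk⟩
  refine (reesClass_eq_zero (F := F) (F' := I.succFiltration M) (z := ⟨z, hzn⟩)).mp ?_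
  refine hs _ ?_ ⟨k, fun b hb => ?_⟩
  · rw [← Ideal.map_pow]
    exact reesClass_mem_map_smul_top (F := F) hz
  · rw [← Ideal.map_pow] at hb
    have hle : (𝔪 ^ k).map (algebraMap R (ReesRing I)) ≤
        (Submodule.span (ReesRing I)
          {F.reesClass (I.succFiltration M) n ⟨z, hzn⟩}).annihilator := by
      rw [Ideal.map_le_iff_le_comap]
      intro a ha
      rw [Ideal.mem_comap, Submodule.mem_annihilator_span_singleton, algebraMap_smul_reesClass,
        reesClass_eq_zero]
      exact hk a ha
    have := hle hb
    rwa [Submodule.mem_annihilator_span_singleton] at this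

lemma exists_mem_sup_saturatedFiltration (𝔪 I : Ideal R) :
    ∃ y ∈ 𝔪, ∃ c, ∀ j ≥ c, ∀ n, ∀ z ∈ (I ^ n • ⊤ : Submodule R M),
      y • z ∈ (𝔪 ^ j • (I ^ n • ⊤) ⊔ I ^ (n + 1) • ⊤ : Submodule R M) →
      z ∈ 𝔪 ^ (j - c) • (I ^ n • ⊤) ⊔ (saturatedFiltration 𝔪 I M).N n := by
  let F := I.stableFiltration (⊤ : Submodule R M)
  let G := F.ReesQuotient (I.succFiltration M)
  have : Module.Finite (ReesRing I) G := finite_reesQuotient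
    (I.stableFiltration_stable (⊤ : Submodule R M)) (I.succFiltration M)
  let A := {P ∈ associatedPrimes (ReesRing I) G | ¬ 𝔪 ≤ P.comap (algebraMap R (ReesRing I))}
  have hA : A.Finite := (associatedPrimes.finite (ReesRing I) G).subset (Set.sep_subset _ _)
  have hy : ∃ y ∈ 𝔪, ∀ P ∈ A, y ∉ P.comap (algebraMap R (ReesRing I)) := by
    by_contra! h
    have h1 : (𝔪 : Set R) ⊆ ⋃ P ∈ A, (P.comap (algebraMap R (ReesRing I)) : Set R) := by
      intro y hy
      obtain ⟨P, hP, hyP⟩ := h y hy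
      exact Set.mem_biUnion hP hyP
    rw [Ideal.subset_union_prime_finite hA ⊥ ⊥ fun P hP _ _ => ?_] at h1
    · obtain ⟨P, hP, hle⟩ := h1
      exact hP.2 hle
    · have := hP.1.isPrime
      exact Ideal.IsPrime.comap _
  obtain ⟨y, hym, hyA⟩ := hy
  obtain ⟨c, hc⟩ := exists_mem_pow_smul_sub_torsion (M := G)
    (𝔪.map (algebraMap R (ReesRing I))) (y := algebraMap R (ReesRing I) y) (fun P hP hyP => by
      rw [Ideal.map_le_iff_le_comap]
      by_contra hle
      exact hyA P ⟨hP, hle⟩ hyP)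
  refine ⟨y, hym, c, fun j hj n z hz hyz => ?_⟩
  obtain ⟨p, hp, q, hq, hpq⟩ := Submodule.mem_sup.mp hyz
  have hpn : p ∈ F.N n := Submodule.smul_le_right hp
  have hqn : q ∈ F.N n := I.pow_succ_smul_top_le n hq
  obtain ⟨w, hw, k, hk⟩ := hc j hj (F.reesClass (I.succFiltration M) n ⟨z, hz⟩) (by
    rw [algebraMap_smul_reesClass]
    have : y • (⟨z, hz⟩ : F.N n) = ⟨p, hpn⟩ + ⟨q, hqn⟩ := Subtype.ext hpq.symm
    have hq0 : F.reesClass (I.succFiltration M) n ⟨q, hqn⟩ = 0 := reesClass_eq_zero.mpr hq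
    rw [this, reesClass_add, hq0, add_zero, ← Ideal.map_pow]
    exact reesClass_mem_map_smul_top hp)
  rw [← Ideal.map_pow] at hw
  obtain ⟨f, rfl, hf⟩ := exists_of_mem_map_smul_top hw
  rw [← add_sub_cancel ((f : PolynomialModule R M).coeff n) z]
  refine Submodule.add_mem_sup (hf n) ⟨sub_mem hz (Submodule.smul_le_right (hf n)), k, ?_⟩
  intro a ha
  refine smul_sub_mem_of_algebraMap_smul_eq_zero (F := F) (F' := I.succFiltration M)
    (z := ⟨z, hz⟩) (hk _ ?_)
  rw [← Ideal.map_pow]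
  exact Ideal.mem_map_of_mem _ ha

end
end Ideal.Filtration

section
variable {R : Type*} (M : Type*) [CommRing R] [AddCommGroup M] [Module R M] [IsNoetherianRing R]
  [Module.Finite R M]

lemma exists_relLen_saturated_le (𝔪 I : Ideal R) : ∃ C : ℕ, ∀ n,
    relLen (I ^ (n + 1) • ⊤ : Submodule R M) ((Ideal.saturatedFiltration 𝔪 I M).N n) ≤
      C * relLen (𝔪 • (I ^ n • ⊤) ⊔ I ^ (n + 1) • ⊤ : Submodule R M) (I ^ n • ⊤) := by
  obtain ⟨s, hs⟩ := Ideal.Filtration.exists_saturatedFiltration_inf_le (M := M) 𝔪 I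
  obtain ⟨C, hC⟩ := exists_relLen_pow_smul_sup_le (M := M) 𝔪 s
  refine ⟨C, fun n => le_trans ?_ (hC _ _)⟩
  rw [relLen_congr_inf (A' := 𝔪 ^ s • (I ^ n • ⊤) ⊔ I ^ (n + 1) • ⊤)]
  · exact relLen_mono_right _ (Ideal.saturatedFiltration_le 𝔪 I n)
  · have h := Ideal.pow_succ_smul_top_le_saturatedFiltration (M := M) 𝔪 I n
    rw [inf_eq_left.mpr h]
    exact le_antisymm (le_inf le_sup_right h) (hs n)

/-- A lower bound for the length of a graded piece of `gr_I(M)/𝔪ʲ gr_I(M)`. -/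
lemma exists_mul_relLen_le (𝔪 I : Ideal R) : ∃ c : ℕ, ∀ n t : ℕ,
    t * relLen (𝔪 • (I ^ n • ⊤) ⊔ I ^ (n + 1) • ⊤ : Submodule R M) (I ^ n • ⊤) ≤
      relLen (𝔪 ^ (c * t) • (I ^ n • ⊤) ⊔ I ^ (n + 1) • ⊤ : Submodule R M) (I ^ n • ⊤) +
        t * relLen (I ^ (n + 1) • ⊤ : Submodule R M)
          ((Ideal.saturatedFiltration 𝔪 I M).N n) := by
  obtain ⟨y, hy, c, hc⟩ := Ideal.Filtration.exists_mem_sup_saturatedFiltration (M := M) 𝔪 I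
  refine ⟨c + 1, fun n t => ?_⟩
  set B := (I ^ n • ⊤ : Submodule R M) with hB
  set Z := (I ^ (n + 1) • ⊤ : Submodule R M) with hZ
  set L := (Ideal.saturatedFiltration 𝔪 I M).N n with hL
  have hstep : ∀ j ≥ c + 1, ∀ i ≤ j - c,
      relLen (𝔪 • B ⊔ Z) B + relLen (𝔪 ^ i • B ⊔ Z) B ≤
        relLen (𝔪 ^ j • B ⊔ Z) B + relLen Z L := by
    intro j hj i hi
    have hyB : B.map (LinearMap.lsmul R M y) ≤ 𝔪 • B := by
      rintro _ ⟨z, hz, rfl⟩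
      exact Submodule.smul_mem_smul hy hz
    have hA : 𝔪 ^ j • B ≤ 𝔪 • B :=
      Submodule.smul_mono_left (Ideal.pow_le_self (by omega))
    have h1 : relLen (𝔪 • B ⊔ Z) B + relLen (𝔪 ^ i • B ⊔ L) B ≤ relLen (𝔪 ^ j • B ⊔ Z) B := by
      rw [relLen_add (A := 𝔪 ^ j • B ⊔ Z) (B := 𝔪 ^ j • B ⊔ Z ⊔ B.map (LinearMap.lsmul R M y))
        le_sup_left (sup_le (sup_le Submodule.smul_le_right (I.pow_succ_smul_top_le n))
          (hyB.trans Submodule.smul_le_right)), relLen_self_sup, relLen_map, add_comm]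
      refine add_le_add ?_ (relLen_anti_left (sup_le (sup_le_sup_right hA _)
        (hyB.trans le_sup_left)) _)
      rw [relLen_congr_inf (A := (𝔪 ^ j • B ⊔ Z).comap (LinearMap.lsmul R M y))
        (A' := (𝔪 ^ j • B ⊔ Z).comap (LinearMap.lsmul R M y) ⊓ B) (by rw [inf_assoc, inf_idem])]
      refine relLen_anti_left ?_ _
      rintro z ⟨hz, hzB⟩
      have hle : 𝔪 ^ (j - c) • B ⊔ L ≤ 𝔪 ^ i • B ⊔ L :=
        sup_le_sup_right (Submodule.smul_mono_left (Ideal.pow_le_pow_right hi)) _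
      exact hle (hc j (by omega) n z hzB hz)
    have h2 : relLen (𝔪 ^ i • B ⊔ Z) B ≤ relLen Z L + relLen (𝔪 ^ i • B ⊔ L) B := by
      refine (relLen_triangle _ (𝔪 ^ i • B ⊔ L) _).trans (add_le_add_left ?_ _)
      refine (relLen_sup_le _ _ _).trans ?_
      rw [relLen_eq_zero.mpr (le_sup_left : 𝔪 ^ i • B ≤ _), zero_add]
      exact relLen_anti_left le_sup_right _
    calc _ ≤ relLen (𝔪 • B ⊔ Z) B + (relLen Z L + relLen (𝔪 ^ i • B ⊔ L) B) := by gcongr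
      _ = relLen (𝔪 • B ⊔ Z) B + relLen (𝔪 ^ i • B ⊔ L) B + relLen Z L := by ring
      _ ≤ _ := by gcongr
  induction t with
  | zero => simp
  | succ t ih =>
    have := hstep ((c + 1) * (t + 1)) (by nlinarith) ((c + 1) * t) (by
      rw [mul_add]; omega)
    calc ((t + 1 : ℕ) : ℕ∞) * relLen (𝔪 • B ⊔ Z) B
        = relLen (𝔪 • B ⊔ Z) B + t * relLen (𝔪 • B ⊔ Z) B := by push_cast; ring
      _ ≤ relLen (𝔪 • B ⊔ Z) B +
          (relLen (𝔪 ^ ((c + 1) * t) • B ⊔ Z) B + t * relLen Z L) := by gcongr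
      _ = relLen (𝔪 • B ⊔ Z) B + relLen (𝔪 ^ ((c + 1) * t) • B ⊔ Z) B + t * relLen Z L := by
          ring
      _ ≤ relLen (𝔪 ^ ((c + 1) * (t + 1)) • B ⊔ Z) B + relLen Z L + t * relLen Z L := by gcongr
      _ = _ := by push_cast; ring

end

section
variable {R M : Type*} [CommRing R] [AddCommGroup M] [Module R M]

lemma mLength_fiberPiece (𝔪 I : Ideal R) (n : ℕ) :
    mLength R (fiberPiece 𝔪 I (M := M) n) =
      relLen (𝔪 • (I ^ n • ⊤) ⊔ I ^ (n + 1) • ⊤ : Submodule R M) (I ^ n • ⊤) :=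
  (Module.length_eq_height R _).symm

lemma mem_H0 {𝔪 : Ideal R} {z : M} : z ∈ H0 𝔪 M ↔ ∃ k : ℕ, ∀ a ∈ 𝔪 ^ k, a • z = 0 := by
  have hmono : Monotone fun n : ℕ =>
      Submodule.torsionBySet R M ((𝔪 ^ n : Ideal R) : Set R) := fun i j h =>
    Submodule.torsionBySet_le_torsionBySet_of_subset (Ideal.pow_le_pow_right h)
  rw [H0, Submodule.mem_iSup_of_directed _ hmono.directed_le]
  simp [Submodule.mem_torsionBySet_iff]

lemma mLength_H0_gradedPiece (𝔪 I : Ideal R) (n : ℕ) :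
    mLength R (H0 𝔪 (gradedPiece I (M := M) n)) =
      relLen (I ^ (n + 1) • ⊤ : Submodule R M) ((Ideal.saturatedFiltration 𝔪 I M).N n) := by
  have h : (H0 𝔪 (gradedPiece I (M := M) n)).map (gradedPiece I n).subtype =
      ((Ideal.saturatedFiltration 𝔪 I M).N n).map (I ^ (n + 1) • ⊤ : Submodule R M).mkQ := by
    ext z
    constructor
    · rintro ⟨⟨_, z, hz, rfl⟩, hk, rfl⟩
      obtain ⟨k, hk⟩ := mem_H0.mp hk
      refine ⟨z, ⟨hz, k, fun a ha => ?_⟩, rfl⟩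
      exact (Submodule.Quotient.mk_eq_zero _).mp (congrArg Subtype.val (hk a ha))
    · rintro ⟨z, ⟨hz, k, hk⟩, rfl⟩
      refine ⟨⟨_, z, hz, rfl⟩, mem_H0.mpr ⟨k, fun a ha => Subtype.ext ?_⟩, rfl⟩
      exact (Submodule.Quotient.mk_eq_zero _).mpr (hk a ha)
  rw [mLength, ← Module.length_eq_height R (H0 𝔪 (gradedPiece I (M := M) n)), relLen, ← h]
  exact (Submodule.equivMapOfInjective _ (Submodule.subtype_injective _) _).length_eq

lemma supportDim_lt_of_mDim_le [Module.Finite R M] {d : ℕ} (h : mDim R M ≤ (d : WithBot ℕ∞)) :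
    Module.supportDim R M < ((d + 1 : ℕ) : WithBot ℕ∞) := by
  rw [mDim, ← Module.supportDim_eq_ringKrullDim_quotient_annihilator] at h
  refine h.trans_lt ?_
  exact_mod_cast Nat.lt_succ_self d

end

section
open Polynomial Asymptotics

lemma exists_forall_le_mul_of_forall_ge {g k : ℕ → ℕ} (hk : ∀ n, 0 < k n) {C n₀ : ℕ}
    (h : ∀ n ≥ n₀, g n ≤ C * k n) : ∃ C', ∀ n, g n ≤ C' * k n := by
  refine ⟨C + ∑ i ∈ Finset.range n₀, g i, fun n => ?_⟩
  rcases lt_or_ge n n₀ with hn | hn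
  · have h1 : g n ≤ ∑ i ∈ Finset.range n₀, g i :=
      Finset.single_le_sum (f := g) (fun _ _ => Nat.zero_le _) (Finset.mem_range.mpr hn)
    have := hk n
    nlinarith
  · exact (h n hn).trans (Nat.mul_le_mul_right _ (Nat.le_add_right _ _))

lemma Polynomial.degree_le_of_forall_ge_abs_eval_le {P : ℝ[X]} {e n₀ : ℕ} {C : ℝ}
    (h : ∀ n : ℕ, n₀ ≤ n → |P.eval (n : ℝ)| ≤ C * (n + 1 : ℝ) ^ e) : P.degree ≤ e := by
  by_contra! hlt
  have hQ : ((X + 1 : ℝ[X]) ^ e).degree = e := by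
    rw [degree_pow, ← C_1, degree_X_add_C, nsmul_one]
  have hlim := (P.abs_div_tendsto_atTop_atTop_of_degree_gt ((X + 1) ^ e) (by rwa [hQ])
    (pow_ne_zero _ (by rw [← C_1]; exact X_add_C_ne_zero 1))).comp tendsto_natCast_atTop_atTop
  obtain ⟨n, hn, hnC⟩ := ((eventually_ge_atTop n₀).and
    (hlim.eventually_gt_atTop C)).exists
  have hpos : (0 : ℝ) < (n + 1 : ℝ) ^ e := by positivity
  simp only [Function.comp_apply, eval_pow, eval_add, eval_X, eval_one, abs_div,
    abs_of_pos hpos] at hnC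
  rw [lt_div_iff₀ hpos] at hnC
  exact (h n hn).not_gt hnC

lemma Polynomial.exists_forall_ge_abs_eval_le {P : ℝ[X]} {e : ℕ} (h : P.degree ≤ e) :
    ∃ C n₀ : ℕ, ∀ n : ℕ, n₀ ≤ n → |P.eval (n : ℝ)| ≤ C * (n + 1 : ℝ) ^ e := by
  have hQ : ((X + 1 : ℝ[X]) ^ e).degree = e := by
    rw [degree_pow, ← C_1, degree_X_add_C, nsmul_one]
  obtain ⟨c, hc⟩ := (P.isBigO_atTop_of_degree_le ((X + 1) ^ e) (by rwa [hQ])).bound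
  obtain ⟨n₀, hn₀⟩ := eventually_atTop.mp (tendsto_natCast_atTop_atTop.eventually hc)
  obtain ⟨C, hC⟩ := exists_nat_ge c
  refine ⟨C, n₀, fun n hn => ?_⟩
  have hpos : (0 : ℝ) < (n + 1 : ℝ) ^ e := by positivity
  have := hn₀ n hn
  simp only [eval_pow, eval_add, eval_X, eval_one, Real.norm_eq_abs, abs_of_pos hpos] at this
  exact this.trans (by gcongr)

/-- Numerical criterion: `a` has the growth `nᵉ` exactly when `f` does. -/
lemma limUnder_ne_zero_iff_sInf_eq {a f : ℕ → ℕ} {e n₀ C₁ C₂ : ℕ} {p : ℚ[X]}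
    (hp : ∀ n ≥ n₀, (a n : ℚ) = p.eval (n : ℚ)) (haf : ∀ n, a n ≤ C₁ * f n)
    (hf : ∀ n ≥ n₀, f n ≤ C₂ * (n + 1) ^ e)
    (hfa : ∀ n ≥ n₀, (n + 1) * f n ≤ C₂ * (n + 1) ^ e + (n + 1) * a n) :
    limUnder atTop (fun n : ℕ => (e.factorial : ℝ) / (n : ℝ) ^ e * (a n : ℝ)) ≠ 0 ↔
      sInf {δ : ℕ | ∃ C : ℕ, ∀ n : ℕ, f n * (n + 1) ≤ C * (n + 1) ^ δ} = e + 1 := by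
  set S := {δ : ℕ | ∃ C : ℕ, ∀ n : ℕ, f n * (n + 1) ≤ C * (n + 1) ^ δ} with hS
  let P : ℝ[X] := p.map (algebraMap ℚ ℝ)
  have hP : ∀ n ≥ n₀, P.eval (n : ℝ) = a n := by
    intro n hn
    rw [eval_natCast_map, ← hp n hn, map_natCast]
  have hlim : ∀ {l : ℝ}, Tendsto (fun x => P.eval x / (X ^ e : ℝ[X]).eval x) atTop (nhds l) →
      limUnder atTop (fun n : ℕ => (e.factorial : ℝ) / (n : ℝ) ^ e * (a n : ℝ)) =
        e.factorial * l := by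
    intro l hl
    refine Tendsto.limUnder_eq ?_
    refine ((hl.comp tendsto_natCast_atTop_atTop).const_mul (e.factorial : ℝ)).congr' ?_
    filter_upwards [eventually_ge_atTop n₀] with n hn
    simp only [Function.comp_apply, hP n hn, eval_pow, eval_X]
    ring
  have hdeg : P.degree ≤ e := by
    refine degree_le_of_forall_ge_abs_eval_le (n₀ := n₀) (C := C₁ * C₂) fun n hn => ?_
    rw [hP n hn, Nat.abs_cast]
    have := (haf n).trans (Nat.mul_le_mul_left C₁ (hf n hn))
    rw [← mul_assoc] at this
    exact_mod_cast this
  rcases hdeg.lt_or_eq with hlt | heq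
  · have h0 := hlim (P.div_tendsto_atTop_zero_of_degree_lt (X ^ e) (by rwa [degree_X_pow]))
    rw [h0, mul_zero]
    refine iff_of_false (by simp) fun hSe => ?_
    have hd : ((X + 1) * P).degree ≤ (e : WithBot ℕ) := by
      rw [degree_mul, ← C_1, degree_X_add_C, add_comm]
      exact Nat.WithBot.add_one_le_of_lt hlt
    obtain ⟨C, n₁, hC⟩ := exists_forall_ge_abs_eval_le hd
    have heS : e ∈ S := by
      refine exists_forall_le_mul_of_forall_ge (C := C₂ + C) (n₀ := max n₀ n₁)
        (fun n => by positivity) fun n hn => ?_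
      have h1 := hC n (le_of_max_le_right hn)
      have h2 := hfa n (le_of_max_le_left hn)
      rw [eval_mul, hP n (le_of_max_le_left hn)] at h1
      simp only [eval_add, eval_X, eval_one] at h1
      have h3 : (n + 1) * a n ≤ C * (n + 1) ^ e := by
        exact_mod_cast (le_abs_self _).trans h1
      rw [mul_comm (f n), add_mul C₂]
      exact h2.trans (Nat.add_le_add_left h3 _)
    have := Nat.sInf_le heS
    omega
  · have h0 := hlim (P.div_tendsto_atTop_leadingCoeff_div_of_degree_eq (X ^ e)
      (by rwa [degree_X_pow]))
    have hP0 : P ≠ 0 := by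
      rintro h
      rw [h, degree_zero] at heq
      simp at heq
    rw [h0]
    refine iff_of_true (mul_ne_zero (by positivity) (by simpa using hP0)) ?_
    have heS : e + 1 ∈ S := by
      refine exists_forall_le_mul_of_forall_ge (C := C₂) (n₀ := n₀)
        (fun n => by positivity) fun n hn => ?_
      rw [pow_succ, ← mul_assoc]
      exact Nat.mul_le_mul_right _ (hf n hn)
    refine le_antisymm (Nat.sInf_le heS) ?_
    by_contra! hlt
    obtain ⟨C, hC⟩ := Nat.sInf_mem (s := S) ⟨_, heS⟩
    have hd : ((X + 1) * P).degree ≤ (e : WithBot ℕ) := by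
      refine degree_le_of_forall_ge_abs_eval_le (n₀ := n₀) (C := C₁ * C) fun n hn => ?_
      rw [eval_mul, hP n hn]
      simp only [eval_add, eval_X, eval_one]
      rw [abs_of_nonneg (by positivity)]
      have : (n + 1) * a n ≤ C₁ * C * (n + 1) ^ e := calc
        (n + 1) * a n ≤ C₁ * (f n * (n + 1)) := by nlinarith [haf n]
        _ ≤ C₁ * (C * (n + 1) ^ sInf S) := Nat.mul_le_mul_left _ (hC n)
        _ ≤ C₁ * (C * (n + 1) ^ e) := by gcongr <;> omega
        _ = _ := by ring
      exact_mod_cast this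
    rw [degree_mul, ← C_1, degree_X_add_C, heq] at hd
    norm_cast at hd
    omega

end

/-- Lemma 3.1: `j_d(I, M) ≠ 0` iff `ℓ(I, M) = d`. -/
theorem stmt_5 {R : Type*} [CommRing R] [IsNoetherianRing R] [IsLocalRing R]
    (hdim : 0 < ringKrullDim R) (hres : Infinite (IsLocalRing.ResidueField R))
    (I : Ideal R) (hI : I ≠ ⊤)
    (M : Type*) [AddCommGroup M] [Module R M] [Module.Finite R M]
    (d : ℕ) (hd : 0 < d) (hMd : mDim R M ≤ (d : WithBot ℕ∞)) :
    jMult (IsLocalRing.maximalIdeal R) I M d ≠ 0 ↔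
      analyticSpread (IsLocalRing.maximalIdeal R) I M = d := by
  obtain ⟨e, rfl⟩ := Nat.exists_eq_add_of_le' hd
  have hdim_lt := supportDim_lt_of_mDim_le hMd
  set 𝔪 := IsLocalRing.maximalIdeal R with h𝔪
  obtain ⟨n₁, K, hK⟩ := exists_relLen_fiber_le hI (e + 1) M hdim_lt
  obtain ⟨p, n₂, hp⟩ := eventuallyPolynomial_relLen_saturated (M := M) hI hdim_lt
  obtain ⟨C₁, hC₁⟩ := exists_relLen_saturated_le M 𝔪 I
  obtain ⟨c, hc⟩ := exists_mul_relLen_le M 𝔪 I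
  simp only [← mLength_H0_gradedPiece, ← mLength_fiberPiece] at hC₁ hc hp hK
  have hfin : ∀ n, mLength R (fiberPiece 𝔪 I (M := M) n) ≠ ⊤ := fun n => by
    rw [mLength_fiberPiece]
    exact relLen_smul_sup_ne_top (IsNoetherian.noetherian _) _
  have ha : ∀ n, ((mLength R (H0 𝔪 (gradedPiece I (M := M) n))).toNat : ℕ∞) =
      mLength R (H0 𝔪 (gradedPiece I (M := M) n)) := fun n =>
    ENat.natCast_toNat
      (ne_top_of_le_ne_top (WithTop.mul_ne_top (ENat.natCast_ne_top _) (hfin n)) (hC₁ n))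
  have hf : ∀ n, ((mLength R (fiberPiece 𝔪 I (M := M) n)).toNat : ℕ∞) =
      mLength R (fiberPiece 𝔪 I (M := M) n) := fun n => ENat.natCast_toNat (hfin n)
  have hpow : ∀ n b j, n + j + 1 ≤ b * (n + 1) → K * Nat.multichoose (e + 1) (n + j) ≤
      K * b ^ e * (n + 1) ^ e := fun n b j h => by
    rw [mul_assoc, ← mul_pow]
    exact Nat.mul_le_mul_left _ ((Nat.multichoose_le_pow e _).trans (Nat.pow_le_pow_left h e))
  refine limUnder_ne_zero_iff_sInf_eq (n₀ := max n₁ n₂) (C₁ := C₁)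
    (C₂ := K * (c + 2) ^ e) (p := p) (fun n hn => ?_) (fun n => ?_) (fun n hn => ?_)
    (fun n hn => ?_)
  · obtain ⟨a, ha, hap⟩ := hp n (le_of_max_le_right hn)
    rwa [ha, ENat.toNat_natCast]
  · have := hC₁ n
    rw [← ha, ← hf] at this
    exact_mod_cast this
  · have h1 := hK n (le_of_max_le_left hn) 1
    rw [pow_one, ← hf] at h1
    exact (Nat.cast_le.mp h1).trans (hpow n (c + 2) 1 (by nlinarith))
  · have h1 := hc n (n + 1)
    have h2 := h1.trans (add_le_add_left (hK n (le_of_max_le_left hn) _) _)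
    rw [← ha, ← hf] at h2
    refine le_trans (by exact_mod_cast h2)
      (Nat.add_le_add_right (hpow n (c + 2) (c * (n + 1)) ?_) _)
    nlinarith

end
end

section
/- Let (R, 𝔪) be a Noetherian local ring with dim R > 0 and R/𝔪 infinite, let I be a proper ideal, let M be a finitely generated R-module, and let d ≥ 2 be an integer with dim_R M ≤ d. Assume dim_R(M/IM) < dim_R(M). Then for a general element a ∈ I (i.e., for all a in a suitable nonempty Zariski-open set of choices modulo 𝔪I) one has dim_R(M/aM) ≤ d−1 and j_d(I, M) = j_{d−1}(I, M/aM). -/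
open Filter

noncomputable section

/-- The Hilbert–Samuel multiplicity `e(I; N)` of a `d`-dimensional module `N`
(equal to `0` if `N = 0`), defined as `lim_n d!/n^d · length_R (N/IⁿN)`. -/
def hsMult {R : Type*} [CommRing R] (I : Ideal R) (N : Type*) [AddCommGroup N]
    [Module R N] (d : ℕ) : ℝ :=
  limUnder atTop fun n : ℕ =>
    (d.factorial : ℝ) / (n : ℝ) ^ d *
      ((mLength R (N ⧸ (I ^ n • ⊤ : Submodule R N))).toNat : ℝ)

/-- `K :_M I^∞ = ⋃ₙ (K :_M Iⁿ)`. -/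
def satur {R : Type*} [CommRing R] (I : Ideal R) {M : Type*} [AddCommGroup M] [Module R M]
    (K : Submodule R M) : Submodule R M :=
  Submodule.comap K.mkQ (H0 I (M ⧸ K))

/-- "For general elements `a₁, …, aᵢ` of `I`", i.e. for all `i`-tuples of elements of `I`
whose coefficient vectors with respect to any finite generating set of `I` avoid the zero
locus of some nonzero polynomial over the residue field `R/𝔪` (equivalently, whose images
lie in a suitable nonempty Zariski-open set of choices modulo `𝔪I`), property `P` holds. -/
def GeneralElts {R : Type*} [CommRing R] (𝔪 I : Ideal R) (i : ℕ)
    (P : (Fin i → R) → Prop) : Prop :=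
  ∀ (m : ℕ) (x : Fin m → R), Ideal.span (Set.range x) = I →
    ∃ F : MvPolynomial (Fin i × Fin m) R,
      MvPolynomial.map (Ideal.Quotient.mk 𝔪) F ≠ 0 ∧
      ∀ c : Fin i × Fin m → R,
        MvPolynomial.eval (fun p => Ideal.Quotient.mk 𝔪 (c p))
          (MvPolynomial.map (Ideal.Quotient.mk 𝔪) F) ≠ 0 →
        P fun j => ∑ l, c (j, l) * x l


/-! ### Filter-regular elements -/

theorem exists_forall_mem_pow_smul_top_eq_zero {S N : Type*} [CommRing S] [IsNoetherianRing S]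
    [AddCommGroup N] [Module S N] [Module.Finite S N] (J : Ideal S) (l : S)
    (hl : ∀ P ∈ associatedPrimes S N, ¬ J ≤ P → l ∉ P) :
    ∃ s : ℕ, ∀ u ∈ (J ^ s • ⊤ : Submodule S N), l • u = 0 → u = 0 := by
  set K : Submodule S N := LinearMap.ker (LinearMap.lsmul S N l) with hK
  have hJ : J ≤ (Module.annihilator S K).radical := by
    rw [← Ideal.sInf_minimalPrimes]
    refine le_sInf fun P hP => ?_
    have hPN : P ∈ associatedPrimes S N :=
      associatedPrimes.subset_of_injective K.subtype_injective
        (Module.associatedPrimes.minimalPrimes_annihilator_subset_associatedPrimes S K hP)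
    by_contra hJP
    refine hl P hPN hJP (hP.1.2 ?_)
    rw [Module.mem_annihilator]
    rintro ⟨u, hu⟩
    exact Subtype.ext hu
  obtain ⟨t, ht⟩ := Ideal.exists_pow_le_of_le_radical_of_fg hJ (IsNoetherian.noetherian J)
  obtain ⟨k, hk⟩ := J.exists_pow_inf_eq_pow_smul K
  refine ⟨k + t, fun u hu hlu => ?_⟩
  have h1 : u ∈ (J ^ (k + t) • ⊤ ⊓ K : Submodule S N) := ⟨hu, hlu⟩
  rw [hk _ (Nat.le_add_right _ _), Nat.add_sub_cancel_left] at h1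
  have h2 : u ∈ J ^ t • K :=
    (smul_mono_right (J ^ t) inf_le_right : J ^ t • (J ^ k • ⊤ ⊓ K) ≤ J ^ t • K) h1
  rw [← Submodule.mem_bot S]
  refine Submodule.smul_le.2 (fun r hr v hv => ?_) h2
  exact congrArg Subtype.val (Module.mem_annihilator.1 (ht hr) (⟨v, hv⟩ : K))

theorem mem_H0_iff {R N : Type*} [CommRing R] [AddCommGroup N] [Module R N] {I : Ideal R} {u : N} :
    u ∈ H0 I N ↔ ∃ k : ℕ, ∀ r ∈ I ^ k, r • u = 0 := by
  rw [H0, Submodule.mem_iSup_of_directed]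
  · simp [Submodule.mem_torsionBySet_iff]
  · refine Monotone.directed_le fun i j hij => ?_
    exact Submodule.torsionBySet_le_torsionBySet_of_subset (Ideal.pow_le_pow_right hij)

theorem exists_forall_mem_H0_smul_eq_zero {R N : Type*} [CommRing R] [IsNoetherianRing R]
    [AddCommGroup N] [Module R N] [Module.Finite R N] (I : Ideal R) :
    ∃ k : ℕ, ∀ u ∈ H0 I N, ∀ r ∈ I ^ k, r • u = 0 := by
  have hmono : Monotone fun n : ℕ => Submodule.torsionBySet R N ((I ^ n : Ideal R) : Set R) :=
    fun i j hij => Submodule.torsionBySet_le_torsionBySet_of_subset (Ideal.pow_le_pow_right hij)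
  obtain ⟨k, hk⟩ := monotone_stabilizes_iff_noetherian.2 (inferInstance : IsNoetherian R N)
    ⟨_, hmono⟩
  refine ⟨k, fun u hu r hr => ?_⟩
  obtain ⟨j, hj⟩ := mem_H0_iff.1 hu
  have h1 : u ∈ Submodule.torsionBySet R N ((I ^ max j k : Ideal R) : Set R) := by
    rw [Submodule.mem_torsionBySet_iff]
    rintro ⟨r, hr⟩
    exact hj r (Ideal.pow_le_pow_right (le_max_left _ _) hr)
  have h2 := hk (max j k) (le_max_right _ _)
  simp only [OrderHom.coe_mk] at h2
  rw [← h2, Submodule.mem_torsionBySet_iff] at h1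
  exact h1 ⟨r, hr⟩

theorem isFiniteLength_of_pow_maximalIdeal_smul_eq_zero {R N : Type*} [CommRing R]
    [IsNoetherianRing R] [IsLocalRing R] [AddCommGroup N] [Module R N] [Module.Finite R N] (k : ℕ)
    (hk : ∀ u : N, ∀ r ∈ IsLocalRing.maximalIdeal R ^ k, r • u = 0) : IsFiniteLength R N := by
  rcases Nat.eq_zero_or_pos k with rfl | hpos
  · have : Subsingleton N := ⟨fun x y => by
      rw [← one_smul R x, ← one_smul R y, hk x 1 (by simp), hk y 1 (by simp)]⟩
    exact .of_subsingleton
  have hmin : IsLocalRing.maximalIdeal R ∈ (IsLocalRing.maximalIdeal R ^ k).minimalPrimes :=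
    ⟨⟨inferInstance, Ideal.pow_le_self hpos.ne'⟩, fun P hP _ => hP.1.le_of_pow_le hP.2⟩
  have := IsLocalRing.quotient_artinian_of_mem_minimalPrimes_of_isLocalRing _ hmin
  have htors : Module.IsTorsionBySet R N ((IsLocalRing.maximalIdeal R ^ k : Ideal R) : Set R) :=
    fun u r => hk u r r.2
  let := htors.module
  have : IsScalarTower R (R ⧸ IsLocalRing.maximalIdeal R ^ k) N := htors.isScalarTower
  have : Module.Finite (R ⧸ IsLocalRing.maximalIdeal R ^ k) N := .of_restrictScalars_finite R _ _
  have hart : IsArtinian (R ⧸ IsLocalRing.maximalIdeal R ^ k) N := isArtinian_of_fg_of_artinian'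
  have : IsArtinian R N :=
    isArtinian_of_surjective_algebraMap (R := R ⧸ IsLocalRing.maximalIdeal R ^ k)
      Ideal.Quotient.mk_surjective
  exact isFiniteLength_iff_isNoetherian_isArtinian.2 ⟨inferInstance, this⟩

theorem mLength_H0_ne_top {R N : Type*} [CommRing R] [IsNoetherianRing R] [IsLocalRing R]
    [AddCommGroup N] [Module R N] [Module.Finite R N] :
    mLength R (H0 (IsLocalRing.maximalIdeal R) N) ≠ ⊤ := by
  obtain ⟨k, hk⟩ := exists_forall_mem_H0_smul_eq_zero (N := N) (IsLocalRing.maximalIdeal R)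
  rw [mLength, ← Module.length_eq_height, Module.length_ne_top_iff]
  exact isFiniteLength_of_pow_maximalIdeal_smul_eq_zero k
    fun u r hr => Subtype.ext (hk u u.2 r hr)

/-! ### Filtrations and the Rees module -/

section Rees

variable {R : Type*} [CommRing R] (I : Ideal R) {M : Type*} [AddCommGroup M] [Module R M]

/-- The degree-one inclusion `a ↦ a t` of `I` into its Rees algebra `R[It]`. -/
def reesDegOne : I →ₗ[R] reesAlgebra I where
  toFun a := ⟨Polynomial.monomial 1 (a : R), reesAlgebra.monomial_mem.2 (by simp)⟩
  map_add' a b := Subtype.ext (by simp)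
  map_smul' r a := Subtype.ext (by simp [Polynomial.smul_monomial])

variable (M) in
/-- The Rees module `⨁ IⁿM tⁿ`. -/
def ReesModule : Type _ := (I.stableFiltration (⊤ : Submodule R M)).submodule

instance : AddCommGroup (ReesModule I M) :=
  Submodule.addCommGroup (R := reesAlgebra I) (I.stableFiltration (⊤ : Submodule R M)).submodule

instance : Module (reesAlgebra I) (ReesModule I M) :=
  Submodule.module (R := reesAlgebra I) (I.stableFiltration (⊤ : Submodule R M)).submodule

variable {I}

/-- The homogeneous element `u tⁿ` of the Rees module. -/
def reesSingle {n : ℕ} {u : M} (hu : u ∈ (I ^ n • ⊤ : Submodule R M)) : ReesModule I M :=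
  ⟨PolynomialModule.single R n u, fun i => by
    rw [PolynomialModule.coeff_single, Finsupp.single_apply]
    split_ifs with h
    · exact h ▸ hu
    · exact zero_mem _⟩

/-- The submodule of the Rees module defined by a filtration. -/
def Ideal.Filtration.reesSubmodule (F : I.Filtration M) :
    Submodule (reesAlgebra I) (ReesModule I M) where
  carrier := {f | f.1 ∈ F.submodule}
  add_mem' hf hg := F.submodule.add_mem hf hg
  zero_mem' := F.submodule.zero_mem
  smul_mem' r _ hf := F.submodule.smul_mem r hf

theorem reesSingle_mem_reesSubmodule {F : I.Filtration M} {n : ℕ} {u : M}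
    (hu : u ∈ (I ^ n • ⊤ : Submodule R M)) :
    reesSingle hu ∈ F.reesSubmodule ↔ u ∈ F.N n := by
  constructor
  · intro h
    simpa [reesSingle] using h n
  · intro h i
    simp only [reesSingle, PolynomialModule.coeff_single,
      Finsupp.single_apply]
    split_ifs with hi
    · exact hi ▸ h
    · exact zero_mem _

theorem reesDegOne_smul_reesSingle (a : I) {n : ℕ} {u : M}
    (hu : u ∈ (I ^ n • ⊤ : Submodule R M)) :
    ∃ h : (a : R) • u ∈ (I ^ (n + 1) • ⊤ : Submodule R M),
      reesDegOne I a • reesSingle hu = reesSingle h := by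
  refine ⟨by rw [pow_succ', mul_smul]; exact Submodule.smul_mem_smul a.2 hu, Subtype.ext ?_⟩
  change Polynomial.monomial 1 (a : R) • PolynomialModule.single R n u = _
  rw [PolynomialModule.monomial_smul_single, add_comm]
  rfl

theorem algebraMap_smul_reesSingle (r : R) {n : ℕ} {u : M}
    (hu : u ∈ (I ^ n • ⊤ : Submodule R M)) :
    algebraMap R (reesAlgebra I) r • reesSingle hu =
      reesSingle (Submodule.smul_mem _ r hu) := by
  refine Subtype.ext ?_
  change Polynomial.monomial 0 r • PolynomialModule.single R n u = _
  rw [PolynomialModule.monomial_smul_single, zero_add]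
  rfl

theorem reesSingle_mem_pow_smul_top {n : ℕ} {u : M} (hu : u ∈ (I ^ n • ⊤ : Submodule R M)) :
    reesSingle hu ∈ (Ideal.span (Set.range (reesDegOne I)) ^ n • ⊤ :
      Submodule (reesAlgebra I) (ReesModule I M)) := by
  induction n generalizing u with
  | zero => simp
  | succ n ih =>
    have hu' := hu
    rw [pow_succ', mul_smul] at hu'
    induction hu' using Submodule.smul_induction_on' with
    | smul a ha v hv =>
      obtain ⟨h, e⟩ := reesDegOne_smul_reesSingle ⟨a, ha⟩ hv
      have h2 := Submodule.smul_mem_smul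
        (Ideal.subset_span (Set.mem_range_self (f := reesDegOne I) ⟨a, ha⟩)) (ih hv)
      rw [e] at h2
      rw [pow_succ', Submodule.mul_smul]
      exact h2
    | add x hx y hy ihx ihy =>
      have hx' : x ∈ (I ^ (n + 1) • ⊤ : Submodule R M) := by rwa [pow_succ', mul_smul]
      have hy' : y ∈ (I ^ (n + 1) • ⊤ : Submodule R M) := by rwa [pow_succ', mul_smul]
      have e : reesSingle hu = reesSingle hx' + reesSingle hy' :=
        Subtype.ext (PolynomialModule.single_add n.succ x y)
      rw [e]
      exact add_mem (ihx hx') (ihy hy')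

variable [IsNoetherianRing R] [Module.Finite R M]

instance : Module.Finite (reesAlgebra I) (ReesModule I M) :=
  Module.Finite.iff_fg.2 (((I.stableFiltration ⊤).submodule_fg_iff_stable
    fun _ => IsNoetherian.noetherian _).2 (I.stableFiltration_stable ⊤))

theorem Ideal.Filtration.exists_finite_forall_smul_mem (F : I.Filtration M) :
    ∃ 𝒰 : Set (Ideal R), 𝒰.Finite ∧ (∀ U ∈ 𝒰, ¬ I ≤ U) ∧
      ∀ a ∈ I, (∀ U ∈ 𝒰, a ∉ U) → ∃ n₀ : ℕ, ∀ n ≥ n₀, ∀ u ∈ (I ^ n • ⊤ : Submodule R M),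
        a • u ∈ F.N (n + 1) → u ∈ F.N n := by
  set N := ReesModule I M ⧸ F.reesSubmodule
  set J : Ideal (reesAlgebra I) := Ideal.span (Set.range (reesDegOne I)) with hJ
  let c : Ideal (reesAlgebra I) → Ideal R := fun P =>
    ((P.restrictScalars R).comap (reesDegOne I)).map I.subtype
  have hc : ∀ P (a : I), (a : R) ∈ c P ↔ reesDegOne I a ∈ P := by
    intro P a
    simp [c]
  refine ⟨c '' {P | P ∈ associatedPrimes (reesAlgebra I) N ∧ ¬ J ≤ P},
    ((associatedPrimes.finite _ N).subset fun P hP => hP.1).image _, ?_, ?_⟩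
  · rintro _ ⟨P, ⟨-, hP⟩, rfl⟩ h
    refine hP (Ideal.span_le.2 ?_)
    rintro _ ⟨a, rfl⟩
    exact (hc P a).1 (h a.2)
  · intro a ha hau
    obtain ⟨s, hs⟩ := exists_forall_mem_pow_smul_top_eq_zero (N := N) J (reesDegOne I ⟨a, ha⟩)
      fun P hP hJP h => hau _ ⟨P, ⟨hP, hJP⟩, rfl⟩ ((hc P ⟨a, ha⟩).2 h)
    refine ⟨s, fun n hn u hu hau => ?_⟩
    have h1 : F.reesSubmodule.mkQ (reesSingle hu) ∈
        (J ^ s • ⊤ : Submodule (reesAlgebra I) N) := by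
      have h2 := Submodule.mem_map_of_mem (f := F.reesSubmodule.mkQ)
        (Submodule.smul_mono_left (Ideal.pow_le_pow_right hn) (reesSingle_mem_pow_smul_top hu))
      rw [Submodule.map_smul''] at h2
      exact SetLike.le_def.1 (Submodule.smul_mono le_rfl le_top) h2
    have h2 := hs _ h1
    obtain ⟨h, e⟩ := reesDegOne_smul_reesSingle ⟨a, ha⟩ hu
    rw [← map_smul, e, Submodule.mkQ_apply, Submodule.mkQ_apply, Submodule.Quotient.mk_eq_zero,
      Submodule.Quotient.mk_eq_zero, reesSingle_mem_reesSubmodule,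
      reesSingle_mem_reesSubmodule] at h2
    exact h2 hau

theorem Ideal.Filtration.exists_mem_forall_smul_mem (𝔪 : Ideal R) (F : I.Filtration M)
    (hF : ∀ n, ∀ u ∈ (I ^ n • ⊤ : Submodule R M), (∀ r ∈ 𝔪, r • u ∈ F.N n) → u ∈ F.N n) :
    ∃ y ∈ 𝔪, ∀ n, ∀ u ∈ (I ^ n • ⊤ : Submodule R M), y • u ∈ F.N n → u ∈ F.N n := by
  set N := ReesModule I M ⧸ F.reesSubmodule
  have hfin := associatedPrimes.finite (reesAlgebra I) N
  have h : ¬ (𝔪 : Set R) ⊆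
      ⋃ P ∈ associatedPrimes (reesAlgebra I) N, (P.comap (algebraMap R (reesAlgebra I)) : Ideal R)
      := by
    rw [Ideal.subset_union_prime_finite hfin ⊤ ⊤ fun P hP _ _ => by
      have := IsAssociatedPrime.isPrime hP
      exact Ideal.comap_isPrime _ _]
    rintro ⟨P, hP, hle⟩
    obtain ⟨hprime, x, rfl⟩ := isAssociatedPrime_iff.1 hP
    obtain ⟨f, rfl⟩ := F.reesSubmodule.mkQ_surjective x
    refine hprime.ne_top ((Ideal.eq_top_iff_one _).2 ?_)
    rw [Submodule.mem_colon_singleton, one_smul, Submodule.mem_bot, Submodule.mkQ_apply,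
      Submodule.Quotient.mk_eq_zero]
    intro i
    refine hF i _ (f.2 i) fun r hr => ?_
    have h1 := hle hr
    rw [Ideal.mem_comap, Submodule.mem_colon_singleton, Submodule.mem_bot, ← map_smul,
      Submodule.mkQ_apply, Submodule.Quotient.mk_eq_zero] at h1
    have h2 : (algebraMap R (reesAlgebra I) r • (f.1 : PolynomialModule R M)).coeff i ∈ F.N i :=
      h1 i
    rwa [algebraMap_smul] at h2
  obtain ⟨y, hy, hyP⟩ := Set.not_subset.1 h
  refine ⟨y, hy, fun n u hu hyu => ?_⟩
  by_contra hne
  have h0 : F.reesSubmodule.mkQ (reesSingle hu) ≠ 0 := by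
    rwa [ne_eq, Submodule.mkQ_apply, Submodule.Quotient.mk_eq_zero, reesSingle_mem_reesSubmodule]
  obtain ⟨P, hP, hle⟩ := exists_le_isAssociatedPrime_of_isNoetherianRing (reesAlgebra I) _ h0
  refine hyP (Set.mem_biUnion hP (hle ?_))
  rw [Submodule.mem_colon_singleton, ← map_smul, algebraMap_smul_reesSingle, Submodule.mkQ_apply,
    Submodule.mem_bot, Submodule.Quotient.mk_eq_zero, reesSingle_mem_reesSubmodule]
  exact hyu

end Rees

/-! ### Superficial elements -/

section Superficial

variable {R : Type*} [CommRing R] {M : Type*} [AddCommGroup M] [Module R M]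

theorem mem_satur_iff {I : Ideal R} {K : Submodule R M} {u : M} :
    u ∈ satur I K ↔ ∃ k : ℕ, ∀ r ∈ I ^ k, r • u ∈ K := by
  simp only [satur, Submodule.mem_comap, mem_H0_iff, Submodule.mkQ_apply,
    ← Submodule.Quotient.mk_smul, Submodule.Quotient.mk_eq_zero]

theorem le_satur (I : Ideal R) (K : Submodule R M) : K ≤ satur I K := fun _ hu =>
  mem_satur_iff.2 ⟨0, fun r _ => K.smul_mem r hu⟩

theorem satur_mono (I : Ideal R) {K L : Submodule R M} (h : K ≤ L) : satur I K ≤ satur I L :=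
  fun _ hu => mem_satur_iff.2 ((mem_satur_iff.1 hu).imp fun _ hk r hr => h (hk r hr))

theorem mem_satur_of_forall_smul_mem [IsNoetherianRing R] [Module.Finite R M] {I : Ideal R}
    {K : Submodule R M} {u : M} (hu : ∀ r ∈ I, r • u ∈ satur I K) : u ∈ satur I K := by
  obtain ⟨k, hk⟩ := exists_forall_mem_H0_smul_eq_zero (N := M ⧸ K) I
  refine mem_satur_iff.2 ⟨k + 1, fun x hx => ?_⟩
  rw [pow_succ] at hx
  induction hx using Submodule.mul_induction_on' with
  | mem_mul_mem s hs r hr =>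
    have h := hk _ (hu r hr) s hs
    rwa [← map_smul, Submodule.mkQ_apply, Submodule.Quotient.mk_eq_zero, smul_smul] at h
  | add x _ y _ hx hy => rw [add_smul]; exact add_mem hx hy


variable (𝔪 I : Ideal R)

variable (M) in
/-- The filtration `I^{n+1}M`. -/
def shiftedFiltration : I.Filtration M where
  N n := I ^ (n + 1) • ⊤
  mono n := Submodule.smul_mono_left (Ideal.pow_le_pow_right (Nat.le_succ _))
  smul_le n := by rw [← Submodule.mul_smul, ← pow_succ']

variable (M) in
/-- The filtration `IⁿM ∩ (I^{n+1}M :_M 𝔪^∞)`. -/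
def saturFiltration : I.Filtration M where
  N n := I ^ n • ⊤ ⊓ satur 𝔪 (I ^ (n + 1) • ⊤)
  mono n := inf_le_inf (Submodule.smul_mono_left (Ideal.pow_le_pow_right (Nat.le_succ _)))
    (satur_mono _ (Submodule.smul_mono_left (Ideal.pow_le_pow_right (Nat.le_succ _))))
  smul_le n := by
    refine Submodule.smul_le.2 fun a ha u hu => ⟨?_, ?_⟩
    · rw [pow_succ', Submodule.mul_smul]
      exact Submodule.smul_mem_smul ha hu.1
    · obtain ⟨k, hk⟩ := mem_satur_iff.1 hu.2
      refine mem_satur_iff.2 ⟨k, fun r hr => ?_⟩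
      rw [smul_comm, pow_succ', Submodule.mul_smul]
      exact Submodule.smul_mem_smul ha (hk r hr)

variable (M) in
/-- The filtration `y IⁿM`. -/
def mulFiltration (y : R) : I.Filtration M where
  N n := Ideal.span {y} • (I ^ n • ⊤ : Submodule R M)
  mono n := Submodule.smul_mono le_rfl
    (Submodule.smul_mono_left (Ideal.pow_le_pow_right (Nat.le_succ _)))
  smul_le n := by
    rw [← Submodule.mul_smul, ← Submodule.mul_smul, ← Submodule.mul_smul, pow_succ']
    exact le_of_eq (by congr 1; ring)

theorem mem_span_singleton_smul {y : R} {N : Submodule R M} {u : M} :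
    u ∈ Ideal.span {y} • N ↔ ∃ v ∈ N, y • v = u := by
  rw [Submodule.ideal_span_singleton_smul, Submodule.mem_smul_pointwise_iff_exists]

/-- For `a ∈ I`, an asymptotic regularity condition on `gr_I M`, together with the compatibility
of the saturated graded pieces with passing to `M/aM`. -/
structure IsSuperficialFrom (a : R) (n₀ : ℕ) : Prop where
  mem_of_smul_mem : ∀ n ≥ n₀, ∀ u ∈ (I ^ n • ⊤ : Submodule R M),
    a • u ∈ (I ^ (n + 2) • ⊤ : Submodule R M) → u ∈ (I ^ (n + 1) • ⊤ : Submodule R M)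
  exists_smul_eq : ∀ n ≥ n₀, ∀ w : M, a • w ∈ (I ^ (n + 1) • ⊤ : Submodule R M) →
    ∃ v ∈ (I ^ n • ⊤ : Submodule R M), a • v = a • w
  exists_sub_mem : ∀ n ≥ n₀, ∀ u ∈ (I ^ (n + 1) • ⊤ : Submodule R M),
    u ∈ satur 𝔪 (I ^ (n + 2) • ⊤ ⊔ Ideal.span {a} • ⊤ : Submodule R M) →
    ∃ v ∈ (I ^ n • ⊤ : Submodule R M), u - a • v ∈ satur 𝔪 (I ^ (n + 2) • ⊤ : Submodule R M)

variable [IsNoetherianRing R] [Module.Finite R M]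

theorem exists_smul_eq_of_mem_of_smul_mem {a : R} {n₀ : ℕ}
    (h : ∀ n ≥ n₀, ∀ u ∈ (I ^ n • ⊤ : Submodule R M),
      a • u ∈ (I ^ (n + 2) • ⊤ : Submodule R M) → u ∈ (I ^ (n + 1) • ⊤ : Submodule R M)) :
    ∃ n₁, ∀ n ≥ n₁, ∀ w : M, a • w ∈ (I ^ (n + 1) • ⊤ : Submodule R M) →
      ∃ v ∈ (I ^ n • ⊤ : Submodule R M), a • v = a • w := by
  obtain ⟨k, hk⟩ := I.exists_pow_inf_eq_pow_smul (Ideal.span {a} • ⊤ : Submodule R M)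
  refine ⟨n₀ + k, fun n hn w hw => ?_⟩
  obtain ⟨t, rfl⟩ := Nat.exists_eq_add_of_le hn
  have h1 : a • w ∈ (I ^ (n₀ + k + t + 1) • ⊤ ⊓ Ideal.span {a} • ⊤ : Submodule R M) :=
    ⟨hw, mem_span_singleton_smul.2 ⟨w, trivial, rfl⟩⟩
  rw [hk _ (by omega)] at h1
  have h2 : a • w ∈ I ^ (n₀ + k + t + 1 - k) • (Ideal.span {a} • ⊤ : Submodule R M) :=
    SetLike.le_def.1 (Submodule.smul_mono le_rfl inf_le_right) h1
  rw [← Submodule.mul_smul, mul_comm, Submodule.mul_smul, mem_span_singleton_smul] at h2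
  obtain ⟨v, hv, e⟩ := h2
  refine ⟨v, ?_, e⟩
  have key : ∀ j, n₀ + j ≤ n₀ + k + t → v ∈ (I ^ (n₀ + j) • ⊤ : Submodule R M) := by
    intro j
    induction j with
    | zero =>
      exact fun _ => SetLike.le_def.1
        (Submodule.smul_mono_left (Ideal.pow_le_pow_right (by omega))) hv
    | succ j ih =>
      intro hj
      refine h (n₀ + j) (by omega) v (ih (by omega)) ?_
      rw [e]
      exact SetLike.le_def.1 (Submodule.smul_mono_left (Ideal.pow_le_pow_right (by omega))) hw
  have := key (k + t) (by omega)
  rwa [← add_assoc] at this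

theorem exists_finite_isSuperficialFrom :
    ∃ 𝒰 : Set (Ideal R), 𝒰.Finite ∧ (∀ U ∈ 𝒰, ¬ I ≤ U) ∧
      ∀ a ∈ I, (∀ U ∈ 𝒰, a ∉ U) → ∃ n₀ : ℕ, IsSuperficialFrom (M := M) 𝔪 I a n₀ := by
  obtain ⟨y, hy, hyW⟩ := (saturFiltration M 𝔪 I).exists_mem_forall_smul_mem 𝔪
    fun n u hu h => ⟨hu, mem_satur_of_forall_smul_mem fun r hr => (h r hr).2⟩
  have hypow : ∀ k n, ∀ u ∈ (I ^ n • ⊤ : Submodule R M),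
      y ^ k • u ∈ satur 𝔪 (I ^ (n + 1) • ⊤ : Submodule R M) →
      u ∈ satur 𝔪 (I ^ (n + 1) • ⊤ : Submodule R M) := by
    intro k
    induction k with
    | zero => simp
    | succ k ih =>
      intro n u hu h
      rw [pow_succ' y, mul_smul] at h
      exact ih n u hu (hyW n _ (Submodule.smul_mem _ _ hu)
        ⟨Submodule.smul_mem _ _ (Submodule.smul_mem _ _ hu), h⟩).2
  obtain ⟨𝒰, h𝒰, hI𝒰, H⟩ := (shiftedFiltration M I).exists_finite_forall_smul_mem
  obtain ⟨𝒱, h𝒱, hI𝒱, H'⟩ :=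
    (saturFiltration M 𝔪 I ⊔ mulFiltration M I y).exists_finite_forall_smul_mem
  refine ⟨𝒰 ∪ 𝒱, h𝒰.union h𝒱, fun U hU => hU.elim (hI𝒰 U) (hI𝒱 U), fun a ha hau => ?_⟩
  obtain ⟨n₁, h₁⟩ := H a ha fun U hU => hau U (.inl hU)
  obtain ⟨n₂, h₂⟩ := H' a ha fun U hU => hau U (.inr hU)
  obtain ⟨n₃, h₃⟩ := exists_smul_eq_of_mem_of_smul_mem I h₁
  have key : ∀ k, ∀ n ≥ n₂, ∀ v ∈ (I ^ n • ⊤ : Submodule R M),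
      (∃ p ∈ (I ^ (n + 1) • ⊤ : Submodule R M), a • v - y ^ k • p ∈
        satur 𝔪 (I ^ (n + 2) • ⊤ : Submodule R M)) →
      ∃ q ∈ (I ^ n • ⊤ : Submodule R M),
        v - y ^ k • q ∈ satur 𝔪 (I ^ (n + 1) • ⊤ : Submodule R M) := by
    intro k n hn
    have hsm : ∀ v ∈ (I ^ n • ⊤ : Submodule R M),
        a • v ∈ (I ^ (n + 1) • ⊤ : Submodule R M) := fun v hv => by
      rw [pow_succ', Submodule.mul_smul]
      exact Submodule.smul_mem_smul ha hv
    induction k with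
    | zero => exact fun v hv _ => ⟨v, hv, by simp⟩
    | succ k ih =>
      rintro v hv ⟨p, hp, hvp⟩
      have hvF : v ∈ (saturFiltration M 𝔪 I ⊔ mulFiltration M I y).N n := by
        refine h₂ n hn v hv (Submodule.mem_sup.2 ⟨a • v - y ^ (k + 1) • p, ⟨?_, hvp⟩,
          y ^ (k + 1) • p, ?_, sub_add_cancel _ _⟩)
        · exact sub_mem (hsm v hv) (Submodule.smul_mem _ _ hp)
        · exact mem_span_singleton_smul.2 ⟨y ^ k • p, Submodule.smul_mem _ _ hp, by
            rw [smul_smul, ← pow_succ']⟩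
      obtain ⟨w, hw, z, hz, rfl⟩ := Submodule.mem_sup.1 hvF
      obtain ⟨v', hv', rfl⟩ := mem_span_singleton_smul.1 hz
      obtain ⟨q, hq, hq'⟩ := ih v' hv' ⟨p, hp, by
        refine (hyW (n + 1) (a • v' - y ^ k • p)
          (sub_mem (hsm v' hv') (Submodule.smul_mem _ _ hp)) ?_).2
        have haw : a • w ∈ (saturFiltration M 𝔪 I).N (n + 1) :=
          (saturFiltration M 𝔪 I).smul_le n (Submodule.smul_mem_smul ha hw)
        refine ⟨Submodule.smul_mem _ _ (sub_mem (hsm v' hv') (Submodule.smul_mem _ _ hp)), ?_⟩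
        have e : y • (a • v' - y ^ k • p) = a • (w + y • v') - y ^ (k + 1) • p - a • w := by
          module
        rw [e]
        exact sub_mem hvp haw.2⟩
      refine ⟨q, hq, ?_⟩
      have e : w + y • v' - y ^ (k + 1) • q = w + y • (v' - y ^ k • q) := by module
      rw [e]
      exact add_mem hw.2 (Submodule.smul_mem _ y hq')
  refine ⟨max (max n₁ n₂) n₃, fun n hn => h₁ n (by omega), fun n hn => h₃ n (by omega),
    fun n hn u hu hus => ?_⟩
  obtain ⟨k, hk⟩ := mem_satur_iff.1 hus
  obtain ⟨x, hx, z, hz, e⟩ := Submodule.mem_sup.1 (hk _ (Ideal.pow_mem_pow hy k))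
  obtain ⟨w, -, rfl⟩ := mem_span_singleton_smul.1 hz
  have hx' : x ∈ (I ^ (n + 1) • ⊤ : Submodule R M) :=
    SetLike.le_def.1 (Submodule.smul_mono_left (Ideal.pow_le_pow_right (by omega))) hx
  obtain ⟨v, hv, e'⟩ := h₃ n (by omega) w (by
    rw [← eq_sub_iff_add_eq'] at e
    rw [e]
    exact sub_mem (Submodule.smul_mem _ _ hu) hx')
  obtain ⟨q, hq, hvq⟩ := key k n (by omega) v hv ⟨u, hu, le_satur _ _ (by
    rw [e', ← e, sub_add_cancel_right]
    exact neg_mem hx)⟩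
  refine ⟨q, hq, hypow k (n + 1) _ (sub_mem hu ?_) ?_⟩
  · rw [pow_succ', Submodule.mul_smul]
    exact Submodule.smul_mem_smul ha hq
  · have haw : a • (v - y ^ k • q) ∈ (saturFiltration M 𝔪 I).N (n + 1) :=
      (saturFiltration M 𝔪 I).smul_le n (Submodule.smul_mem_smul ha
        ⟨sub_mem hv (Submodule.smul_mem _ _ hq), hvq⟩)
    have e'' : y ^ k • (u - a • q) = x + a • (v - y ^ k • q) := by
      rw [smul_sub, smul_sub, ← e, ← e', smul_comm a]
      abel
    rw [e'']
    exact add_mem (le_satur 𝔪 _ hx) haw.2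

end Superficial

/-! ### Lengths of the saturated graded pieces -/

section Length

variable {R : Type*} [CommRing R] (𝔪 I : Ideal R) (M : Type*) [AddCommGroup M] [Module R M]

/-- `H⁰_𝔪(IⁿM/I^{n+1}M)` as a submodule of `M/I^{n+1}M`. -/
def saturPiece (n : ℕ) : Submodule R (M ⧸ (I ^ (n + 1) • ⊤ : Submodule R M)) :=
  ((saturFiltration M 𝔪 I).N n).map (Submodule.mkQ _)

theorem map_subtype_H0_gradedPiece (n : ℕ) :
    (H0 𝔪 (gradedPiece I (M := M) n)).map (gradedPiece I n).subtype = saturPiece 𝔪 I M n := by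
  ext x
  constructor
  · rintro ⟨⟨_, u, hu, rfl⟩, h, rfl⟩
    obtain ⟨k, hk⟩ := mem_H0_iff.1 h
    refine ⟨u, ⟨hu, mem_satur_iff.2 ⟨k, fun r hr => ?_⟩⟩, rfl⟩
    rw [← Submodule.Quotient.mk_eq_zero]
    exact congrArg Subtype.val (hk r hr)
  · rintro ⟨u, ⟨hu, hs⟩, rfl⟩
    refine ⟨⟨_, u, hu, rfl⟩, ?_, rfl⟩
    obtain ⟨k, hk⟩ := mem_satur_iff.1 hs
    refine mem_H0_iff.2 ⟨k, fun r hr => Subtype.ext ?_⟩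
    exact (Submodule.Quotient.mk_eq_zero _).2 (hk r hr)

theorem mLength_eq_length (N : Type*) [AddCommGroup N] [Module R N] :
    mLength R N = Module.length R N :=
  (Module.length_eq_height R N).symm

theorem mLength_H0_gradedPiece_s6 (n : ℕ) :
    mLength R (H0 𝔪 (gradedPiece I (M := M) n)) = Module.length R (saturPiece 𝔪 I M n) := by
  rw [mLength_eq_length, ← map_subtype_H0_gradedPiece]
  exact (Submodule.equivMapOfInjective _ (Submodule.subtype_injective _) _).length_eq

variable {M I}

theorem mkQ_mem_pow_smul_top_iff {K : Submodule R M} {n : ℕ} {u : M} :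
    K.mkQ u ∈ (I ^ n • ⊤ : Submodule R (M ⧸ K)) ↔ u ∈ (I ^ n • ⊤ ⊔ K : Submodule R M) := by
  rw [← Submodule.mem_comap, ← Submodule.range_mkQ K, ← Submodule.map_top, ← Submodule.map_smul'',
    Submodule.comap_map_mkQ, sup_comm]

theorem mkQ_mem_satur_pow_smul_top_iff {K : Submodule R M} {n : ℕ} {u : M} :
    K.mkQ u ∈ satur 𝔪 (I ^ n • ⊤ : Submodule R (M ⧸ K)) ↔
      u ∈ satur 𝔪 (I ^ n • ⊤ ⊔ K : Submodule R M) := by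
  simp only [mem_satur_iff, ← map_smul, mkQ_mem_pow_smul_top_iff]

/-- Multiplication by `a ∈ I` from degree `n` to degree `n + 1`. -/
def saturPieceSMul {a : R} (ha : a ∈ I) (n : ℕ) :
    saturPiece 𝔪 I M n →ₗ[R] saturPiece 𝔪 I M (n + 1) :=
  (Submodule.mapQ (I ^ (n + 1) • ⊤) (I ^ (n + 1 + 1) • ⊤) (LinearMap.lsmul R M a)
    fun _ hu => (shiftedFiltration M I).smul_le n (Submodule.smul_mem_smul ha hu)).restrict (by
      rintro _ ⟨u, hu, rfl⟩
      exact ⟨a • u, (saturFiltration M 𝔪 I).smul_le n (Submodule.smul_mem_smul ha hu), rfl⟩)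

/-- The map induced by `M → M/K` in degree `n`. -/
def saturPieceMkQ (K : Submodule R M) (n : ℕ) :
    saturPiece 𝔪 I M n →ₗ[R] saturPiece 𝔪 I (M ⧸ K) n :=
  (Submodule.mapQ (I ^ (n + 1) • ⊤) (I ^ (n + 1) • ⊤) K.mkQ
    fun _ hu => mkQ_mem_pow_smul_top_iff.2 (Submodule.mem_sup_left hu)).restrict (by
      rintro _ ⟨u, hu, rfl⟩
      exact ⟨K.mkQ u, ⟨mkQ_mem_pow_smul_top_iff.2 (Submodule.mem_sup_left hu.1),
        (mkQ_mem_satur_pow_smul_top_iff 𝔪).2 (satur_mono _ le_sup_left hu.2)⟩, rfl⟩)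

variable {𝔪}

theorem IsSuperficialFrom.length_saturPiece_succ {a : R} (ha : a ∈ I) {n₀ : ℕ}
    (h : IsSuperficialFrom (M := M) 𝔪 I a n₀) {n : ℕ} (hn : n₀ ≤ n) :
    Module.length R (saturPiece 𝔪 I M (n + 1)) = Module.length R (saturPiece 𝔪 I M n) +
      Module.length R (saturPiece 𝔪 I (M ⧸ (Ideal.span {a} • ⊤ : Submodule R M)) (n + 1)) := by
  refine Module.length_eq_add_of_exact (saturPieceSMul 𝔪 ha n) (saturPieceMkQ 𝔪 _ (n + 1)) ?_ ?_ ?_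
  · rw [← LinearMap.ker_eq_bot, LinearMap.ker_eq_bot']
    rintro ⟨_, u, hu, rfl⟩ h0
    have h1 := congrArg Subtype.val h0
    refine Subtype.ext ((Submodule.Quotient.mk_eq_zero _).2 (h.mem_of_smul_mem n hn u hu.1 ?_))
    exact (Submodule.Quotient.mk_eq_zero _).1 h1
  · rintro ⟨_, u', hu, rfl⟩
    obtain ⟨u, rfl⟩ := Submodule.mkQ_surjective _ u'
    obtain ⟨x, hx, z, hz, rfl⟩ := Submodule.mem_sup.1 (mkQ_mem_pow_smul_top_iff.1 hu.1)
    obtain ⟨v, hv, hs⟩ := h.exists_sub_mem n hn x hx (by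
      have h1 := (mkQ_mem_satur_pow_smul_top_iff 𝔪).1 hu.2
      have h2 := sub_mem h1 (le_satur 𝔪 _ (Submodule.mem_sup_right hz))
      rwa [add_sub_cancel_right] at h2)
    refine ⟨⟨_, x - a • v, ⟨sub_mem hx ?_, hs⟩, rfl⟩, Subtype.ext ?_⟩
    · rw [pow_succ', Submodule.mul_smul]
      exact Submodule.smul_mem_smul ha hv
    · refine congrArg (Submodule.mkQ _) ((Submodule.Quotient.eq _).2 ?_)
      rw [sub_sub, add_left_comm, sub_add_cancel_left]
      exact neg_mem (add_mem (mem_span_singleton_smul.2 ⟨v, trivial, rfl⟩) hz)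
  · rintro ⟨_, u, hu, rfl⟩
    constructor
    · intro h0
      have h1 : Submodule.mkQ _ u ∈ (I ^ (n + 1 + 1) • ⊤ :
          Submodule R (M ⧸ (Ideal.span {a} • ⊤ : Submodule R M))) :=
        (Submodule.Quotient.mk_eq_zero _).1 (congrArg Subtype.val h0)
      obtain ⟨x, hx, z, hz, rfl⟩ := Submodule.mem_sup.1 (mkQ_mem_pow_smul_top_iff.1 h1)
      obtain ⟨w, -, rfl⟩ := mem_span_singleton_smul.1 hz
      obtain ⟨v, hv, e⟩ := h.exists_smul_eq n hn w (by
        have h2 := sub_mem hu.1 ((shiftedFiltration M I).mono n hx)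
        rwa [add_sub_cancel_left] at h2)
      refine ⟨⟨_, v, ⟨hv, ?_⟩, rfl⟩, Subtype.ext ?_⟩
      · obtain ⟨k, hk⟩ := mem_satur_iff.1 (sub_mem hu.2 (le_satur 𝔪 _ hx))
        refine mem_satur_iff.2 ⟨k, fun r hr =>
          h.mem_of_smul_mem n hn _ (Submodule.smul_mem _ _ hv) ?_⟩
        have h3 := hk r hr
        rwa [add_sub_cancel_left, ← e, smul_comm] at h3
      · refine (Submodule.Quotient.eq _).2 ?_
        change a • v - _ ∈ _
        rw [e, sub_add_cancel_right]
        exact neg_mem hx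
    · rintro ⟨⟨_, v, hv, rfl⟩, e⟩
      rw [← e]
      refine Subtype.ext ((Submodule.Quotient.mk_eq_zero _).2 ?_)
      have h1 : Submodule.mkQ (Ideal.span {a} • ⊤ : Submodule R M) (a • v) = 0 :=
        (Submodule.Quotient.mk_eq_zero _).2 (mem_span_singleton_smul.2 ⟨v, trivial, rfl⟩)
      exact h1 ▸ zero_mem _

end Length

/-! ### The Hilbert function of the saturated associated graded module -/

section HilbertFunction

variable {R : Type*} [CommRing R]

/-- The function `n ↦ length_R (H⁰_𝔪(IⁿM/I^{n+1}M))`. -/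
def jHilbert (𝔪 I : Ideal R) (M : Type*) [AddCommGroup M] [Module R M] (n : ℕ) : ℕ :=
  (mLength R (H0 𝔪 (gradedPiece I (M := M) n))).toNat

variable [IsNoetherianRing R] {M : Type*} [AddCommGroup M] [Module R M] [Module.Finite R M]

theorem exists_finite_jHilbert_succ [IsLocalRing R] (I : Ideal R) :
    ∃ 𝒰 : Set (Ideal R), 𝒰.Finite ∧ (∀ U ∈ 𝒰, ¬ I ≤ U) ∧
      ∀ a ∈ I, (∀ U ∈ 𝒰, a ∉ U) → ∃ n₀ : ℕ, ∀ n ≥ n₀,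
        jHilbert (IsLocalRing.maximalIdeal R) I M (n + 1) =
          jHilbert (IsLocalRing.maximalIdeal R) I M n +
          jHilbert (IsLocalRing.maximalIdeal R) I
            (M ⧸ (Ideal.span {a} • ⊤ : Submodule R M)) (n + 1) := by
  obtain ⟨𝒰, h𝒰, hI𝒰, H⟩ :=
    exists_finite_isSuperficialFrom (M := M) (IsLocalRing.maximalIdeal R) I
  refine ⟨𝒰, h𝒰, hI𝒰, fun a ha hau => ?_⟩
  obtain ⟨n₀, h⟩ := H a ha hau
  refine ⟨n₀, fun n hn => ?_⟩
  rw [jHilbert, jHilbert, jHilbert, ← ENat.toNat_add mLength_H0_ne_top mLength_H0_ne_top,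
    mLength_H0_gradedPiece_s6, mLength_H0_gradedPiece_s6, mLength_H0_gradedPiece_s6,
    h.length_saturPiece_succ ha hn]

theorem exists_pow_smul_top_inf_H0_eq_bot (I : Ideal R) :
    ∃ n₀ : ℕ, ∀ n ≥ n₀, ∀ u ∈ (I ^ n • ⊤ : Submodule R M), u ∈ H0 I M → u = 0 := by
  obtain ⟨t, ht⟩ := exists_forall_mem_H0_smul_eq_zero (N := M) I
  obtain ⟨k, hk⟩ := I.exists_pow_inf_eq_pow_smul (H0 I M)
  refine ⟨k + t, fun n hn u hu hu' => ?_⟩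
  have h1 : u ∈ (I ^ n • ⊤ ⊓ H0 I M : Submodule R M) := ⟨hu, hu'⟩
  rw [hk _ (by omega)] at h1
  rw [← Submodule.mem_bot R]
  refine Submodule.smul_le.2 (fun r hr v hv => ?_) h1
  exact ht v hv.2 r (Ideal.pow_le_pow_right (by omega) hr)

theorem exists_jHilbert_quotient_H0_eq (𝔪 I : Ideal R) :
    ∃ n₀ : ℕ, ∀ n ≥ n₀, jHilbert 𝔪 I (M ⧸ H0 I M) n = jHilbert 𝔪 I M n := by
  obtain ⟨n₀, h⟩ := exists_pow_smul_top_inf_H0_eq_bot (M := M) I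
  refine ⟨n₀, fun n hn => ?_⟩
  have hle : (I ^ (n + 1) • ⊤ : Submodule R M) ≤ I ^ n • ⊤ :=
    Submodule.smul_mono_left (Ideal.pow_le_pow_right (Nat.le_succ _))
  rw [jHilbert, jHilbert, mLength_H0_gradedPiece_s6, mLength_H0_gradedPiece_s6]
  congr 1
  refine (LinearEquiv.ofBijective (saturPieceMkQ 𝔪 (H0 I M) n) ⟨?_, ?_⟩).length_eq.symm
  · rw [← LinearMap.ker_eq_bot, LinearMap.ker_eq_bot']
    rintro ⟨_, u, hu, rfl⟩ h0
    have h1 : Submodule.mkQ _ u ∈ (I ^ (n + 1) • ⊤ : Submodule R (M ⧸ H0 I M)) :=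
      (Submodule.Quotient.mk_eq_zero _).1 (congrArg Subtype.val h0)
    obtain ⟨x, hx, z, hz, rfl⟩ := Submodule.mem_sup.1 (mkQ_mem_pow_smul_top_iff.1 h1)
    have h2 : z ∈ (I ^ n • ⊤ : Submodule R M) := by
      simpa using sub_mem hu.1 (hle hx)
    obtain rfl := h n hn z h2 hz
    exact Subtype.ext ((Submodule.Quotient.mk_eq_zero _).2 (by simpa using hx))
  · rintro ⟨_, u', hu, rfl⟩
    obtain ⟨u, rfl⟩ := Submodule.mkQ_surjective _ u'
    obtain ⟨x, hx, z, hz, rfl⟩ := Submodule.mem_sup.1 (mkQ_mem_pow_smul_top_iff.1 hu.1)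
    have hxz : Submodule.mkQ (H0 I M) (x + z) = Submodule.mkQ (H0 I M) x := by
      simp [hz]
    rw [hxz] at hu
    refine ⟨⟨_, x, ⟨hx, ?_⟩, rfl⟩, Subtype.ext (congrArg (Submodule.mkQ _) hxz.symm)⟩
    obtain ⟨k, hk⟩ := mem_satur_iff.1 ((mkQ_mem_satur_pow_smul_top_iff 𝔪).1 hu.2)
    refine mem_satur_iff.2 ⟨k, fun r hr => ?_⟩
    obtain ⟨v, hv, w, hw, e⟩ := Submodule.mem_sup.1 (hk r hr)
    have h2 : w ∈ (I ^ n • ⊤ : Submodule R M) := by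
      rw [← eq_sub_iff_add_eq'] at e
      exact e ▸ sub_mem (Submodule.smul_mem _ _ hx) (hle hv)
    obtain rfl := h n hn w h2 hw
    rw [← e, add_zero]
    exact hv

theorem not_le_of_mem_minimalPrimes_annihilator_quotient_H0 {I P : Ideal R}
    (hP : P ∈ (Module.annihilator R (M ⧸ H0 I M)).minimalPrimes) : ¬ I ≤ P := by
  intro hIP
  obtain ⟨hprime, x, rfl⟩ := isAssociatedPrime_iff.1
    (Module.associatedPrimes.minimalPrimes_annihilator_subset_associatedPrimes R _ hP)
  obtain ⟨u, rfl⟩ := Submodule.mkQ_surjective _ x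
  refine hprime.ne_top ((Ideal.eq_top_iff_one _).2 ?_)
  rw [Submodule.mem_colon_singleton, one_smul, Submodule.mem_bot, Submodule.mkQ_apply,
    Submodule.Quotient.mk_eq_zero]
  obtain ⟨k, hk⟩ := exists_forall_mem_H0_smul_eq_zero (N := M) I
  refine mem_H0_iff.2 ⟨k + 1, fun r hr => ?_⟩
  rw [pow_succ] at hr
  induction hr using Submodule.mul_induction_on' with
  | mem_mul_mem s hs r hr =>
    rw [mul_smul]
    refine hk _ ?_ s hs
    have h := hIP hr
    rwa [Submodule.mem_colon_singleton, Submodule.mem_bot, ← map_smul, Submodule.mkQ_apply,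
      Submodule.Quotient.mk_eq_zero] at h
  | add x _ y _ hx hy => rw [add_smul, hx, hy, add_zero]

end HilbertFunction

/-! ### Dimension of `M/aM` -/

section Dimension

variable {R : Type*} [CommRing R]

theorem length_le_of_ringKrullDim_quotient_le {A : Ideal R} {d : ℕ}
    (hA : ringKrullDim (R ⧸ A) ≤ d) (p : LTSeries (PrimeSpectrum R)) (hp : A ≤ p.head.asIdeal) :
    p.length ≤ d := by
  have hmem : ∀ i, p i ∈ PrimeSpectrum.zeroLocus (A : Set R) := fun i =>
    (PrimeSpectrum.mem_zeroLocus _ _).2 (hp.trans (PrimeSpectrum.asIdeal_le_asIdeal _ _ |>.2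
      (p.head_le i)))
  let q : LTSeries (PrimeSpectrum.zeroLocus (A : Set R)) :=
    ⟨p.length, fun i => ⟨p i, hmem i⟩, fun i => p.step i⟩
  have h := (Order.LTSeries.length_le_krullDim q).trans ((ringKrullDim_quotient A).symm.trans_le hA)
  exact_mod_cast h

theorem ringKrullDim_quotient_le_of_mem {A B : Ideal R} (hAB : A ≤ B) {a : R} (ha : a ∈ B) {d : ℕ}
    (hA : ringKrullDim (R ⧸ A) ≤ (d + 1 : ℕ))
    (hmin : ∀ P ∈ A.minimalPrimes, a ∈ P → ringKrullDim (R ⧸ P) ≤ d) :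
    ringKrullDim (R ⧸ B) ≤ d := by
  rw [ringKrullDim_quotient, Order.krullDim]
  refine iSup_le fun p => ?_
  let q : LTSeries (PrimeSpectrum R) := p.map Subtype.val fun _ _ h => h
  have hq : B ≤ q.head.asIdeal := (PrimeSpectrum.mem_zeroLocus _ _).1 p.head.2
  have := q.head.2
  obtain ⟨P, hP, hPq⟩ := Ideal.exists_minimalPrimes_le (hAB.trans hq)
  change ((q.length : ℕ∞) : WithBot ℕ∞) ≤ _
  norm_cast
  by_cases haP : a ∈ P
  · exact length_le_of_ringKrullDim_quotient_le (hmin P hP haP) q hPq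
  · have hlt : (⟨P, hP.1.1⟩ : PrimeSpectrum R) < q.head :=
      lt_of_le_of_ne hPq fun h => haP (by
        have h2 := hq ha
        rwa [← h] at h2)
    have h := length_le_of_ringKrullDim_quotient_le hA (q.cons ⟨P, hP.1.1⟩ hlt) (by
      rw [RelSeries.head_cons]; exact hP.1.2)
    simpa using h

variable {M : Type*} [AddCommGroup M] [Module R M]

theorem mDim_quotient_span_singleton_le {a : R} {d : ℕ} (hM : mDim R M ≤ (d + 1 : ℕ))
    (hmin : ∀ P ∈ (Module.annihilator R M).minimalPrimes, a ∈ P → ringKrullDim (R ⧸ P) ≤ d) :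
    mDim R (M ⧸ (Ideal.span {a} • ⊤ : Submodule R M)) ≤ d := by
  refine ringKrullDim_quotient_le_of_mem ?_ ?_ hM hmin
  · exact LinearMap.annihilator_le_of_surjective _ (Submodule.mkQ_surjective _)
  · rw [Submodule.annihilator_quotient, Submodule.mem_colon]
    exact fun u _ => Submodule.smul_mem_smul (Ideal.mem_span_singleton_self a) trivial

theorem mDim_quotient_le (K : Submodule R M) : mDim R (M ⧸ K) ≤ mDim R M :=
  ringKrullDim_le_of_surjective
    (Ideal.Quotient.factor (LinearMap.annihilator_le_of_surjective _ K.mkQ_surjective))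
    (Ideal.Quotient.factor_surjective _)

theorem ringKrullDim_quotient_le_mDim_quotient [Module.Finite R M] {I P : Ideal R} [hP : P.IsPrime]
    (hM : Module.annihilator R M ≤ P) (hI : I ≤ P) :
    ringKrullDim (R ⧸ P) ≤ mDim R (M ⧸ (I • ⊤ : Submodule R M)) := by
  have h : (⟨P, hP⟩ : PrimeSpectrum R) ∈ Module.support R (M ⧸ (I • ⊤ : Submodule R M)) := by
    rw [Module.support_quotient, Module.support_eq_zeroLocus]
    exact ⟨hM, hI⟩
  rw [Module.support_eq_zeroLocus] at h
  exact ringKrullDim_le_of_surjective (Ideal.Quotient.factor h)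
    (Ideal.Quotient.factor_surjective _)

end Dimension

/-! ### General elements -/

section General

open IsLocalRing

variable {R : Type*} [CommRing R] [IsLocalRing R]

theorem exists_linearForm_of_ne_top {ι : Type*} [Fintype ι] {V : Submodule R (ι → R)}
    (hV : V ≠ ⊤) :
    ∃ b : ι → R, (∃ l, b l ∉ maximalIdeal R) ∧ ∀ c ∈ V, ∑ l, b l * c l ∈ maximalIdeal R := by
  classical
  let f : (ι → R) →ₗ[R] (ι → ResidueField R) := (Algebra.linearMap R (ResidueField R)).compLeft ι
  have hf : ∀ c l, f c l = residue R (c l) := fun _ _ => rfl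
  have hsurj : Function.Surjective (algebraMap R (ResidueField R)) := residue_surjective
  have hlt : Submodule.span (ResidueField R) (V.map f : Set (ι → ResidueField R)) < ⊤ := by
    rw [lt_top_iff_ne_top]
    intro h
    refine hV (top_le_iff.1 (Submodule.le_of_le_smul_of_le_jacobson_bot
      Module.Finite.fg_top (maximalIdeal_le_jacobson ⊥) fun c _ => ?_))
    have h1 : f c ∈ V.map f := by
      have h2 : f c ∈ Submodule.span (ResidueField R) (V.map f : Set (ι → ResidueField R)) :=
        h ▸ trivial
      rw [← Submodule.restrictScalars_mem R, Submodule.restrictScalars_span _ _ hsurj] at h2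
      rwa [Submodule.span_eq] at h2
    obtain ⟨v, hv, e⟩ := h1
    refine Submodule.mem_sup.2 ⟨v, hv, c - v, ?_, by simp⟩
    rw [pi_eq_sum_univ (c - v)]
    refine sum_mem fun l _ => Submodule.smul_mem_smul ?_ trivial
    rw [← residue_eq_zero_iff, Pi.sub_apply, map_sub, ← hf, ← hf, e, sub_self]
  obtain ⟨φ, hφ, hle⟩ := Submodule.exists_le_ker_of_lt_top _ hlt
  choose b hb using fun l => residue_surjective (φ (Pi.single l 1))
  have hφ' : ∀ c, φ (f c) = residue R (∑ l, b l * c l) := by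
    intro c
    rw [LinearMap.pi_apply_eq_sum_univ φ, map_sum]
    refine Finset.sum_congr rfl fun l _ => ?_
    rw [hf, map_mul, hb, smul_eq_mul, mul_comm]
    congr 2
    ext j
    simp [Pi.single_apply, eq_comm]
  refine ⟨b, ?_, fun c hc => ?_⟩
  · by_contra! h
    refine hφ (LinearMap.pi_ext' fun l => LinearMap.ext_ring ?_)
    rw [LinearMap.comp_apply, LinearMap.single_apply, ← hb, LinearMap.comp_apply,
      LinearMap.zero_apply]
    exact (residue_eq_zero_iff _).2 (h l)
  · rw [← residue_eq_zero_iff, ← hφ']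
    exact hle (Submodule.subset_span (Submodule.mem_map_of_mem hc))

theorem generalElts_notMem {I : Ideal R} {𝒰 : Set (Ideal R)} (h𝒰 : 𝒰.Finite)
    (hI : ∀ U ∈ 𝒰, ¬ I ≤ U) :
    GeneralElts (maximalIdeal R) I 1 fun a => a 0 ∈ I ∧ ∀ U ∈ 𝒰, a 0 ∉ U := by
  intro m x hx
  have key : ∀ U : 𝒰, ∃ b : Fin m → R, (∃ l, b l ∉ maximalIdeal R) ∧
      ∀ c : Fin m → R, ∑ l, c l * x l ∈ (U : Ideal R) → ∑ l, b l * c l ∈ maximalIdeal R := by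
    intro U
    obtain ⟨b, hb, h⟩ := exists_linearForm_of_ne_top
      (V := Submodule.comap (Fintype.linearCombination R x) (U : Ideal R)) fun h => hI U U.2 (by
        rw [← hx, Ideal.span_le]
        rintro _ ⟨l, rfl⟩
        have h1 : Pi.single l (1 : R) ∈
            Submodule.comap (Fintype.linearCombination R x) (U : Ideal R) :=
          h ▸ trivial
        simpa using h1)
    exact ⟨b, hb, fun c hc => h c (by simpa [Fintype.linearCombination_apply] using hc)⟩
  choose b hb hbU using key
  have := h𝒰.fintype
  let L : 𝒰 → MvPolynomial (Fin 1 × Fin m) R := fun U =>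
    ∑ l, MvPolynomial.C (b U l) * MvPolynomial.X (0, l)
  refine ⟨∏ U, L U, ?_, fun c hc => ⟨?_, ?_⟩⟩
  · rw [map_prod]
    refine Finset.prod_ne_zero_iff.2 fun U _ h0 => ?_
    obtain ⟨l, hl⟩ := hb U
    refine hl (Ideal.Quotient.eq_zero_iff_mem.1 ?_)
    have h1 := congrArg (MvPolynomial.eval (Pi.single (0, l) 1)) h0
    simpa [L, Pi.single_apply] using h1
  · rw [← hx]
    exact sum_mem fun l _ => Ideal.mul_mem_left _ _ (Ideal.subset_span ⟨l, rfl⟩)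
  · intro U hU hmem
    rw [map_prod, map_prod] at hc
    refine Finset.prod_ne_zero_iff.1 hc ⟨U, hU⟩ (Finset.mem_univ _) ?_
    have h1 := Ideal.Quotient.eq_zero_iff_mem.2 (hbU ⟨U, hU⟩ (fun l => c (0, l)) hmem)
    simpa [L] using h1

theorem GeneralElts.exists [IsNoetherianRing R] (hres : Infinite (ResidueField R)) {I : Ideal R}
    {i : ℕ} {P : (Fin i → R) → Prop} (h : GeneralElts (maximalIdeal R) I i P) : ∃ a, P a := by
  obtain ⟨m, x, hx⟩ := Submodule.fg_iff_exists_fin_generating_family.1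
    (IsNoetherian.noetherian I)
  obtain ⟨F, hF, hP⟩ := h m x hx
  have : Infinite (R ⧸ maximalIdeal R) := hres
  by_contra! hne
  refine hF (MvPolynomial.funext fun y => ?_)
  choose c hc using fun p => Ideal.Quotient.mk_surjective (y p)
  obtain rfl : (fun p => Ideal.Quotient.mk (maximalIdeal R) (c p)) = y := funext hc
  by_contra h0
  exact hne _ (hP c (by simpa using h0))

end General

/-! ### Summation of asymptotically polynomial sequences -/

section Asymptotics

open Topology Asymptotics

theorem tendsto_factorial_div_pow_mul_choose (m : ℕ) :
    Tendsto (fun n : ℕ => (m.factorial : ℝ) / (n : ℝ) ^ m * (n.choose m : ℝ)) atTop (𝓝 1) := by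
  have hne : ∀ᶠ n : ℕ in atTop, (n : ℝ) ^ m / (m.factorial : ℝ) ≠ 0 := by
    filter_upwards [eventually_gt_atTop 0] with n hn
    positivity
  refine ((isEquivalent_iff_tendsto_one hne).1 (isEquivalent_choose m)).congr fun n => ?_
  simp only [Pi.div_apply]
  rw [div_div_eq_mul_div, mul_comm, mul_div_right_comm]

theorem eventually_choose_pos (m : ℕ) : ∀ᶠ n : ℕ in atTop, (0 : ℝ) < n.choose m := by
  filter_upwards [eventually_ge_atTop m] with n hn
  exact_mod_cast Nat.choose_pos hn

theorem tendsto_factorial_div_pow_mul_iff {m : ℕ} {h : ℕ → ℝ} {L : ℝ} :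
    Tendsto (fun n : ℕ => (m.factorial : ℝ) / (n : ℝ) ^ m * h n) atTop (𝓝 L) ↔
      Tendsto (fun n : ℕ => h n / (n.choose m : ℝ)) atTop (𝓝 L) := by
  have h1 := tendsto_factorial_div_pow_mul_choose m
  constructor
  · intro H
    have h2 := H.div h1 one_ne_zero
    rw [div_one] at h2
    refine h2.congr' ?_
    filter_upwards [eventually_gt_atTop 0] with n hn
    have : (m.factorial : ℝ) / (n : ℝ) ^ m ≠ 0 := by positivity
    exact mul_div_mul_left _ _ this
  · intro H
    have h2 := h1.mul H
    rw [one_mul] at h2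
    refine h2.congr' ?_
    filter_upwards [eventually_choose_pos m] with n hn
    rw [mul_assoc, mul_div_cancel₀ _ hn.ne']

theorem tendsto_choose_succ_div_choose (m : ℕ) :
    Tendsto (fun n : ℕ => ((n + 1).choose m : ℝ) / (n.choose m : ℝ)) atTop (𝓝 1) := by
  have h1 : Tendsto (fun n : ℕ => (1 : ℝ) - m / ((n + 1 : ℕ) : ℝ)) atTop (𝓝 1) := by
    simpa using ((tendsto_const_div_atTop_nhds_zero_nat (m : ℝ)).comp
      (tendsto_add_atTop_nat 1)).const_sub 1
  have h2 := h1.inv₀ one_ne_zero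
  rw [inv_one] at h2
  refine h2.congr' ?_
  filter_upwards [eventually_ge_atTop m] with n hn
  have h3 : (n.choose m : ℝ) * ((n + 1 : ℕ) : ℝ) =
      ((n + 1).choose m : ℝ) * (((n + 1 : ℕ) : ℝ) - m) := by
    have := Nat.choose_mul_succ_eq n m
    rw [← Nat.cast_sub (by omega)]
    exact_mod_cast this
  have h4 : (0 : ℝ) < n.choose m := by exact_mod_cast Nat.choose_pos hn
  have h5 : (0 : ℝ) < ((n + 1 : ℕ) : ℝ) := by positivity
  have h6 : (0 : ℝ) < ((n + 1 : ℕ) : ℝ) - m := by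
    rw [sub_pos]
    exact_mod_cast Nat.lt_succ_of_le hn
  rw [one_sub_div h5.ne', inv_div, div_eq_div_iff h6.ne' h4.ne', mul_comm, h3]

theorem Finset.sum_range_choose_right (m n : ℕ) :
    ∑ i ∈ Finset.range n, i.choose m = n.choose (m + 1) := by
  induction n with
  | zero => simp
  | succ n ih => rw [Finset.sum_range_succ, ih, Nat.choose_succ_succ, add_comm]

/-- Summation raises the degree of growth by one and preserves the normalized leading
coefficient. -/
theorem tendsto_of_eventually_succ_eq_add {m : ℕ} {h h' : ℕ → ℝ} {L : ℝ}
    (hs : ∀ᶠ n in atTop, h (n + 1) = h n + h' (n + 1))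
    (hL : Tendsto (fun n : ℕ => (m.factorial : ℝ) / (n : ℝ) ^ m * h' n) atTop (𝓝 L)) :
    Tendsto (fun n : ℕ => ((m + 1).factorial : ℝ) / (n : ℝ) ^ (m + 1) * h n) atTop (𝓝 L) := by
  rw [tendsto_factorial_div_pow_mul_iff] at hL ⊢
  have h1 : Tendsto (fun n : ℕ => (h (n + 1) - h n) / (n.choose m : ℝ)) atTop (𝓝 L) := by
    have h2 := (hL.comp (tendsto_add_atTop_nat 1)).mul (tendsto_choose_succ_div_choose m)
    rw [mul_one] at h2
    refine h2.congr' ?_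
    filter_upwards [hs, (tendsto_add_atTop_nat 1).eventually (eventually_choose_pos m)] with n hn hp
    rw [hn, add_sub_cancel_left, Function.comp_apply, div_mul_div_cancel₀ hp.ne']
  have h2 : (fun n : ℕ => (h (n + 1) - h n) - L * (n.choose m : ℝ)) =o[atTop]
      fun n => (n.choose m : ℝ) := by
    refine (isLittleO_iff_tendsto' ?_).2 ?_
    · filter_upwards [eventually_choose_pos m] with n hn h0
      exact absurd h0 hn.ne'
    · have h3 := h1.sub_const L
      rw [sub_self] at h3
      refine h3.congr' ?_
      filter_upwards [eventually_choose_pos m] with n hn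
      rw [sub_div _ (L * _), mul_div_cancel_right₀ _ hn.ne']
  have hsum : ∀ n, ∑ i ∈ Finset.range n, (i.choose m : ℝ) = (n.choose (m + 1) : ℝ) := fun n => by
    exact_mod_cast Finset.sum_range_choose_right m n
  have htop : Tendsto (fun n : ℕ => (n.choose (m + 1) : ℝ)) atTop atTop := by
    refine ((isEquivalent_choose (m + 1)).symm.tendsto_atTop ?_)
    exact ((tendsto_pow_atTop (Nat.succ_ne_zero m)).comp
      tendsto_natCast_atTop_atTop).atTop_div_const (by positivity)
  have h3 := h2.sum_range (fun n => by positivity) (by simpa only [hsum] using htop)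
  have hsum' : ∀ n, ∑ i ∈ Finset.range n, ((h (i + 1) - h i) - L * (i.choose m : ℝ)) =
      h n - h 0 - L * (n.choose (m + 1) : ℝ) := fun n => by
    rw [Finset.sum_sub_distrib, ← Finset.mul_sum, hsum, Finset.sum_range_sub]
  simp only [hsum, hsum'] at h3
  have h4 := h3.tendsto_div_nhds_zero
  have h5 : Tendsto (fun n : ℕ => h 0 / (n.choose (m + 1) : ℝ)) atTop (𝓝 0) :=
    htop.const_div_atTop _
  have h6 := (h4.add h5).add_const L
  rw [add_zero, zero_add] at h6
  refine h6.congr' ?_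
  filter_upwards [eventually_choose_pos (m + 1)] with n hn
  field_simp
  ring

end Asymptotics

/-! ### Existence of the `j`-multiplicity -/

section Existence

open Topology IsLocalRing

variable {R : Type*} [CommRing R] [IsNoetherianRing R] [IsLocalRing R] {I : Ideal R}

theorem exists_jHilbert_eq_zero {M : Type*} [AddCommGroup M] [Module R M]
    (hI : I ≠ ⊤) (hM : mDim R M ≤ (0 : ℕ)) :
    ∃ n₀ : ℕ, ∀ n ≥ n₀, jHilbert (maximalIdeal R) I M n = 0 := by
  have : Ring.KrullDimLE 0 (R ⧸ Module.annihilator R M) := Ring.krullDimLE_iff.2 hM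
  have : IsArtinianRing (R ⧸ Module.annihilator R M) := isArtinianRing_iff_krullDimLE_zero.2 this
  obtain ⟨k, hk⟩ := exists_maximalIdeal_pow_le_of_isArtinianRing_quotient (Module.annihilator R M)
  refine ⟨k, fun n hn => ?_⟩
  have hbot : saturPiece (maximalIdeal R) I M n = ⊥ := by
    rw [eq_bot_iff]
    rintro _ ⟨u, hu, rfl⟩
    have h0 : u = 0 := by
      rw [← Submodule.mem_bot R]
      refine Submodule.smul_le.2 (fun r hr v _ => ?_) hu.1
      exact Module.mem_annihilator.1 (hk (Ideal.pow_le_pow_right hn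
        (Ideal.pow_right_mono (le_maximalIdeal hI) n hr))) v
    simp [h0]
  rw [jHilbert, mLength_H0_gradedPiece_s6, hbot, Module.length_eq_zero_iff.2 inferInstance]
  rfl

variable {M : Type*} [AddCommGroup M] [Module R M] [Module.Finite R M]

/-- A general element of `I` cuts down the dimension and differentiates the Hilbert function. -/
theorem exists_finite_mDim_le_and_jHilbert_succ {d : ℕ} (hM : mDim R M ≤ (d + 1 : ℕ))
    (hmin : ∀ P ∈ (Module.annihilator R M).minimalPrimes, I ≤ P → ringKrullDim (R ⧸ P) ≤ d) :
    ∃ 𝒰 : Set (Ideal R), 𝒰.Finite ∧ (∀ U ∈ 𝒰, ¬ I ≤ U) ∧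
      ∀ a ∈ I, (∀ U ∈ 𝒰, a ∉ U) →
        mDim R (M ⧸ (Ideal.span {a} • ⊤ : Submodule R M)) ≤ d ∧
        ∀ᶠ n in atTop, jHilbert (maximalIdeal R) I M (n + 1) = jHilbert (maximalIdeal R) I M n +
          jHilbert (maximalIdeal R) I (M ⧸ (Ideal.span {a} • ⊤ : Submodule R M)) (n + 1) := by
  obtain ⟨𝒰, h𝒰, hI𝒰, H⟩ := exists_finite_jHilbert_succ (M := M) I
  refine ⟨𝒰 ∪ {P ∈ (Module.annihilator R M).minimalPrimes | ¬ I ≤ P},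
    h𝒰.union ((Ideal.finite_minimalPrimes_of_isNoetherianRing R _).subset fun P hP => hP.1),
    fun U hU => hU.elim (hI𝒰 U) And.right, fun a ha hau => ⟨?_, ?_⟩⟩
  · refine mDim_quotient_span_singleton_le hM fun P hP haP => hmin P hP ?_
    by_contra hIP
    exact hau P (.inr ⟨hP, hIP⟩) haP
  · obtain ⟨n₀, h⟩ := H a ha fun U hU => hau U (.inl hU)
    exact eventually_atTop.2 ⟨n₀, h⟩

theorem exists_tendsto_jHilbert (hres : Infinite (ResidueField R)) (hI : I ≠ ⊤) (m : ℕ)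
    {M : Type*} [AddCommGroup M] [Module R M] [Module.Finite R M]
    (hM : mDim R M ≤ (m + 1 : ℕ)) :
    ∃ L : ℝ, Tendsto (fun n : ℕ => (m.factorial : ℝ) / (n : ℝ) ^ m *
      (jHilbert (maximalIdeal R) I M n : ℝ)) atTop (𝓝 L) := by
  induction m generalizing M with
  | zero =>
    obtain ⟨n₁, h₁⟩ := exists_jHilbert_quotient_H0_eq (M := M) (maximalIdeal R) I
    obtain ⟨𝒰, h𝒰, hI𝒰, H⟩ := exists_finite_mDim_le_and_jHilbert_succ
      ((mDim_quotient_le (H0 I M)).trans hM)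
      fun P hP hIP => absurd hIP (not_le_of_mem_minimalPrimes_annihilator_quotient_H0 hP)
    obtain ⟨a, ha, hau⟩ := (generalElts_notMem h𝒰 hI𝒰).exists hres
    obtain ⟨hd, hs⟩ := H _ ha hau
    obtain ⟨n₂, h₂⟩ := exists_jHilbert_eq_zero hI hd
    obtain ⟨n₃, h₃⟩ := eventually_atTop.1 hs
    refine ⟨jHilbert (maximalIdeal R) I M (max n₁ (max n₂ n₃)),
      tendsto_atTop_of_eventually_const (i₀ := max n₁ (max n₂ n₃)) fun n hn => ?_⟩
    rw [Nat.factorial_zero, pow_zero, Nat.cast_one, div_one, one_mul]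
    congr 1
    induction n, hn using Nat.le_induction with
    | base => rfl
    | succ n hn ih =>
      rw [← ih, ← h₁ _ (by omega), ← h₁ _ (by omega), h₃ n (by omega), h₂ _ (by omega), add_zero]
  | succ m ih =>
    obtain ⟨n₁, h₁⟩ := exists_jHilbert_quotient_H0_eq (M := M) (maximalIdeal R) I
    obtain ⟨𝒰, h𝒰, hI𝒰, H⟩ := exists_finite_mDim_le_and_jHilbert_succ
      ((mDim_quotient_le (H0 I M)).trans hM)
      fun P hP hIP => absurd hIP (not_le_of_mem_minimalPrimes_annihilator_quotient_H0 hP)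
    obtain ⟨a, ha, hau⟩ := (generalElts_notMem h𝒰 hI𝒰).exists hres
    obtain ⟨hd, hs⟩ := H _ ha hau
    obtain ⟨L, hL⟩ := ih hd
    refine ⟨L, (tendsto_of_eventually_succ_eq_add
      (h := fun n => jHilbert (maximalIdeal R) I (M ⧸ H0 I M) n)
      (hs.mono fun n hn => ?_) hL).congr' ?_⟩
    · exact_mod_cast hn
    · filter_upwards [eventually_ge_atTop n₁] with n hn
      rw [h₁ n hn]

end Existence

/-- Lemma 3.2: for a general element `a ∈ I`, `dim (M/aM) ≤ d−1` and
`j_d(I, M) = j_{d−1}(I, M/aM)`. -/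
theorem stmt_6 {R : Type*} [CommRing R] [IsNoetherianRing R] [IsLocalRing R]
    (hdim : 0 < ringKrullDim R) (hres : Infinite (IsLocalRing.ResidueField R))
    (I : Ideal R) (hI : I ≠ ⊤)
    (M : Type*) [AddCommGroup M] [Module R M] [Module.Finite R M]
    (d : ℕ) (hd : 2 ≤ d) (hMd : mDim R M ≤ (d : WithBot ℕ∞))
    (hquot : mDim R (M ⧸ (I • ⊤ : Submodule R M)) < mDim R M) :
    GeneralElts (IsLocalRing.maximalIdeal R) I 1 fun a =>
      mDim R (M ⧸ (Ideal.span {a 0} • ⊤ : Submodule R M)) ≤ ((d - 1 : ℕ) : WithBot ℕ∞) ∧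
      jMult (IsLocalRing.maximalIdeal R) I M d =
        jMult (IsLocalRing.maximalIdeal R) I
          (M ⧸ (Ideal.span {a 0} • ⊤ : Submodule R M)) (d - 1) := by
  obtain ⟨e, rfl⟩ := Nat.exists_eq_add_of_le' hd
  obtain ⟨𝒰, h𝒰, hI𝒰, H⟩ := exists_finite_mDim_le_and_jHilbert_succ
    (M := M) (I := I) (d := e + 1) hMd
    fun P hP hIP => by
      have := hP.1.1
      have h1 := (ringKrullDim_quotient_le_mDim_quotient (M := M) hP.1.2 hIP).trans_lt
        (hquot.trans_le hMd)
      exact (ENat.WithBot.lt_add_one_iff (m := e + 1)).1 (by exact_mod_cast h1)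
  intro m x hx
  obtain ⟨F, hF, hP⟩ := generalElts_notMem h𝒰 hI𝒰 m x hx
  refine ⟨F, hF, fun c hc => ?_⟩
  obtain ⟨ha, hau⟩ := hP c hc
  obtain ⟨hd, hs⟩ := H _ ha hau
  refine ⟨hd, ?_⟩
  obtain ⟨L, hL⟩ := exists_tendsto_jHilbert hres hI e hd
  have hL' := tendsto_of_eventually_succ_eq_add
    (h := fun n => jHilbert (IsLocalRing.maximalIdeal R) I M n)
    (hs.mono fun n hn => by exact_mod_cast hn) hL
  exact hL'.limUnder_eq.trans hL.limUnder_eq.symm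

end
end
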